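/- For all integers ν ≥ 1, 0 ≤ s, b ≤ ν, and L ≥ 2, the following identity of polynomials in q holds: F^ν_{s,b}(L,q) = W^ν_{s+1,ν−b}(L,q) if b + s ≡ νL (mod 2), and F^ν_{s,b}(L,q) = W^ν_{2ν+2−s,ν−b}(L,q) if b + s ≢ νL (mod 2). -/

import Mathlib

open scoped Classical

noncomputable section

/-- The q-Pochhammer symbol `(q)_n = ∏_{j=1}^n (1 - q^j)`. -/
def qP {F : Type*} [Field F] (q : F) (n : ℕ) : F :=
  ∏ j ∈ Finset.range n, (1 - q ^ (j + 1))

/-- The q-binomial coefficient `[N choose k]_q = (q)_N / ((q)_k (q)_{N-k})`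
for `0 ≤ k ≤ N`, and `0` otherwise. -/
def qB {F : Type*} [Field F] (q : F) (N k : ℤ) : F :=
  if 0 ≤ k ∧ k ≤ N then qP q N.toNat / (qP q k.toNat * qP q (N - k).toNat) else 0

/-- `NN n i = N_i = n_i + n_{i+1} + ⋯ + n_ν` (indices 1-based; `n ⟨k⟩` is `n_{k+1}`). -/
def NN {ν : ℕ} (n : Fin ν → ℕ) (i : ℕ) : ℕ :=
  ∑ k : Fin ν, if i ≤ (k : ℕ) + 1 then n k else 0

/-- `α_{i,s} = max(0, i - s)`. -/
def alph (i s : ℕ) : ℤ := max 0 ((i : ℤ) - s)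

/-- The exponent `N_1² + ⋯ + N_ν² + N_{s+1} + ⋯ + N_ν`. -/
def expAG (ν s : ℕ) (nn : Fin ν → ℕ) : ℕ :=
  (∑ i ∈ Finset.Icc 1 ν, (NN nn i) ^ 2) + ∑ i ∈ Finset.Icc (s + 1) ν, NN nn i

/-- The polynomial `B^ν_{s,b}(L,q)` of Foda–Quano–Kirillov type. -/
def B {F : Type*} [Field F] (ν : ℕ) (s b : ℤ) (L : ℕ) (q : F) : F :=
  ∑ᶠ j : ℤ,
    (q ^ (j * ((2 * j + 1) * (2 * (ν : ℤ) + 3) - 2 * s)) *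
        qB q (L : ℤ) (((L : ℤ) + b - s) / 2 + j * (2 * (ν : ℤ) + 3)) -
      q ^ ((2 * j + 1) * ((2 * (ν : ℤ) + 3) * j + s)) *
        qB q (L : ℤ) (((L : ℤ) + b + s) / 2 + j * (2 * (ν : ℤ) + 3)))

/-- `jjf j l = j_l` for `1 ≤ l ≤ ν` (and junk value `0` otherwise). -/
def jjf {ν : ℕ} (j : Fin ν → ℕ) (l : ℕ) : ℤ :=
  if h : l - 1 < ν then (j ⟨l - 1, h⟩ : ℤ) else 0

/-- The q-multinomial coefficient `[L choose a]^(p)_ν`. -/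
def qMulti {F : Type*} [Field F] (ν L : ℕ) (a : ℤ) (p : ℕ) (q : F) : F :=
  ∑ᶠ j : Fin ν → ℕ,
    if (∑ l, (j l : ℤ)) = a then
      q ^ ((∑ l ∈ Finset.Icc 2 ν, jjf j (l - 1) * ((L : ℤ) - jjf j l)) -
            ∑ l ∈ Finset.Icc 1 p, jjf j l) *
        qB q (L : ℤ) (jjf j ν) * ∏ l ∈ Finset.Icc 2 ν, qB q (jjf j l) (jjf j (l - 1))
    else 0

/-- The polynomial `W^ν_{s,b}(L,q)` of Warnaar type. -/
def W {F : Type*} [Field F] (ν : ℕ) (s : ℤ) (b L : ℕ) (q : F) : F :=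
  ∑ᶠ j : ℤ,
    (q ^ (j * ((2 * j + 1) * (2 * (ν : ℤ) + 3) - 2 * s)) *
        qMulti ν L (((ν : ℤ) * ((L : ℤ) + 1) - s - b + 1) / 2 + (2 * (ν : ℤ) + 3) * j) b q -
      q ^ ((2 * j + 1) * ((2 * (ν : ℤ) + 3) * j + s)) *
        qMulti ν L (((ν : ℤ) * ((L : ℤ) + 1) + s - b + 1) / 2 + (2 * (ν : ℤ) + 3) * j) b q)

/-! ### Bressoud lattice paths -/

/-- Step values: `0 ↦ NE (+1)`, `1 ↦ SE (−1)`, `2 ↦ horizontal (0)`. -/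
def stepVal : Fin 3 → ℤ := ![1, -1, 0]

/-- Height of the path after `k` steps, starting at height `s`. -/
def hts (s : ℤ) {n : ℕ} (d : Fin n → Fin 3) (k : ℕ) : ℤ :=
  s + ∑ i ∈ Finset.range k, if h : i < n then stepVal (d ⟨i, h⟩) else 0

/-- The vertex `k` is a peak: it is preceded by a NE step and followed by a SE step. -/
def IsPeak {n : ℕ} (d : Fin n → Fin 3) (k : ℕ) : Prop :=
  ∃ hk : k < n, 1 ≤ k ∧ d ⟨k - 1, Nat.lt_of_le_of_lt (Nat.sub_le k 1) hk⟩ = 0 ∧ d ⟨k, hk⟩ = 1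

/-- `d` encodes a Bressoud path from height `s` to height `b` whose peaks have height `≤ ν`:
SE steps only from positive height, horizontal steps only on the x-axis. -/
def ValidPath (ν : ℕ) (s b : ℤ) {n : ℕ} (d : Fin n → Fin 3) : Prop :=
  hts s d n = b ∧
    (∀ k : Fin n, (d k = 1 → 0 < hts s d (k : ℕ)) ∧ (d k = 2 → hts s d (k : ℕ) = 0)) ∧
    (∀ k : ℕ, IsPeak d k → hts s d k ≤ (ν : ℤ))

/-- The weight of a Bressoud path starting at x-coordinate `M`:
the sum of the x-coordinates of its peaks. -/
def pwt (M : ℤ) {n : ℕ} (d : Fin n → Fin 3) : ℤ :=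
  ∑ k ∈ Finset.range (n + 1), if IsPeak d k then M + (k : ℤ) else 0

/-- `C^ν_{M,L}(s,b,q)`: the weighted count of Bressoud paths from `(M,s)` to `(L,b)`
with no peak higher than `ν`. -/
def Cpoly {F : Type*} [Field F] (ν : ℕ) (M L : ℤ) (s b : ℕ) (q : F) : F :=
  ∑ d ∈ Finset.univ.filter (fun d : Fin (L - M).toNat → Fin 3 => ValidPath ν (s : ℤ) (b : ℤ) d),
    q ^ pwt M d

/-- `t` is an admissible relative height for the peak at vertex `k`. -/
def RelProp (s : ℤ) {n : ℕ} (d : Fin n → Fin 3) (k t : ℕ) : Prop :=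
  0 < t ∧ ∃ k' k'' : ℕ, k' < k ∧ k < k'' ∧ k'' ≤ n ∧
    hts s d k' = hts s d k - t ∧ hts s d k'' = hts s d k - t ∧
    ∀ m : ℕ, k' < m → m < k'' → IsPeak d m →
      hts s d m ≤ hts s d k ∧ (hts s d m = hts s d k → k ≤ m)

/-- The relative height of the peak at vertex `k`: the largest `t` with `RelProp`. -/
def relHt (ν : ℕ) (s : ℤ) {n : ℕ} (d : Fin n → Fin 3) (k : ℕ) : ℕ :=
  Nat.findGreatest (RelProp s d k) (ν + n)

/-- `P^ν_{M,L}(s,b,n)`: Bressoud paths from `(M,s)` to `(L,b)`, peaks of height at most `ν`,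
with exactly `nn j` peaks of relative height `j+1`. -/
def Pset (ν : ℕ) (M L : ℤ) (s b : ℤ) (nn : Fin ν → ℕ) : Finset (Fin (L - M).toNat → Fin 3) :=
  Finset.univ.filter (fun d => ValidPath ν s b d ∧
    ∀ j : Fin ν, ((Finset.range ((L - M).toNat + 1)).filter
      (fun k => IsPeak d k ∧ relHt ν s d k = (j : ℕ) + 1)).card = nn j)

/-! ### Gordon lattice paths -/

/-- `f` encodes a Gordon path of length `n` from height `s` to height `b`:
`f 0 = s`, `f n = b`, adjacent frequencies sum to at most `ν`; values beyond `n` are `0`. -/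
def IsGordon (ν n s b : ℕ) (f : ℕ → ℕ) : Prop :=
  f 0 = s ∧ f n = b ∧ (∀ k, k < n → f k + f (k + 1) ≤ ν) ∧ (∀ k, n < k → f k = 0)

/-- The weight `Σ_{j=M+1}^{L-1} j f_j` of a Gordon path starting at x-coordinate `M`. -/
def gwt (M : ℤ) (n : ℕ) (f : ℕ → ℕ) : ℤ :=
  ∑ k ∈ Finset.Ioo 0 n, (M + (k : ℤ)) * (f k : ℤ)

/-- `G^ν_{M,L}(s,b,q)`: the weighted count of Gordon paths from `(M,s)` to `(L,b)`. -/
def G {F : Type*} [Field F] (ν : ℕ) (M L : ℤ) (s b : ℕ) (q : F) : F :=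
  ∑ᶠ f : ℕ → ℕ, if IsGordon ν (L - M).toNat s b f then q ^ gwt M (L - M).toNat f else 0

/-- `F^ν_{s,b}(L,q)` of (2.21). -/
def Fpoly {F : Type*} [Field F] (ν s b L : ℕ) (q : F) : F :=
  ∑ᶠ nn : Fin ν → ℕ, q ^ expAG ν s nn *
    ∏ i : Fin ν, qB q ((nn i : ℤ) + ((i : ℕ) + 1) * (L : ℤ) -
      2 * (∑ l ∈ Finset.Icc 1 ((i : ℕ) + 1), (NN nn l : ℤ)) -
      alph ((i : ℕ) + 1) s - alph ((i : ℕ) + 1) b) (nn i)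

/-- The left-hand side of (4.2): `F` with the extra `−M(N_1+⋯+N_ν)` in the exponent. -/
def FpolyM {F : Type*} [Field F] (ν s b L M : ℕ) (q : F) : F :=
  ∑ᶠ nn : Fin ν → ℕ,
    q ^ ((expAG ν s nn : ℤ) - (M : ℤ) * ∑ i ∈ Finset.Icc 1 ν, (NN nn i : ℤ)) *
    ∏ i : Fin ν, qB q ((nn i : ℤ) + ((i : ℕ) + 1) * (L : ℤ) -
      2 * (∑ l ∈ Finset.Icc 1 ((i : ℕ) + 1), (NN nn l : ℤ)) -
      alph ((i : ℕ) + 1) s - alph ((i : ℕ) + 1) b) (nn i)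


abbrev K : Type := RatFunc ℚ


/-! ### q-binomial basics -/

lemma qP_ne {F : Type*} [Field F] {q : F} (hq1 : ∀ n : ℕ, 0 < n → q ^ n ≠ 1) (n : ℕ) :
    qP q n ≠ 0 := by
  unfold qP
  rw [Finset.prod_ne_zero_iff]
  intro j _ h
  exact hq1 (j + 1) (Nat.succ_pos j) (sub_eq_zero.mp h).symm

lemma qP_succ {F : Type*} [Field F] (q : F) (n : ℕ) :
    qP q (n + 1) = qP q n * (1 - q ^ (n + 1)) := by
  unfold qP
  rw [Finset.prod_range_succ]

lemma qB_zero {F : Type*} [Field F] {q : F} (hq1 : ∀ n : ℕ, 0 < n → q ^ n ≠ 1) (N : ℤ) :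
    qB q N 0 = if 0 ≤ N then 1 else 0 := by
  unfold qB
  have h := qP_ne hq1 N.toNat
  by_cases hN : 0 ≤ N
  · rw [if_pos ⟨le_rfl, hN⟩, if_pos hN]
    have : qP q 0 = 1 := by simp [qP]
    simp [this, h]
  · rw [if_neg (by tauto), if_neg hN]

lemma qB_eq_zero {F : Type*} [Field F] (q : F) {N k : ℤ} (h : N < k) : qB q N k = 0 := by
  unfold qB
  rw [if_neg (by omega)]

lemma qB_pascal {F : Type*} [Field F] {q : F} (hq1 : ∀ n : ℕ, 0 < n → q ^ n ≠ 1)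
    (N : ℤ) (n : ℕ) :
    qB q (N + (n + 1 : ℕ)) (n + 1 : ℕ) - qB q (N - 1 + (n + 1 : ℕ)) (n + 1 : ℕ)
      = q ^ N * qB q (N + n) n := by
  rcases lt_trichotomy N 0 with hN | hN | hN
  · rw [qB_eq_zero q (by omega), qB_eq_zero q (by omega), qB_eq_zero q (by omega)]
    simp
  · subst hN
    rw [qB_eq_zero q (N := 0 - 1 + _) (by omega)]
    have h1 := qP_ne hq1 n
    have h2 := qP_ne hq1 (n + 1)
    have : qP q 0 = 1 := by simp [qP]
    have e1 : ((n : ℤ) + 1).toNat = n + 1 := by omega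
    have e2 : (0 : ℤ) ≤ (n : ℤ) + 1 := by omega
    simp [qB, this, h1, h2, e1, e2]
  · obtain ⟨m, rfl⟩ : ∃ m : ℕ, N = m + 1 := ⟨(N - 1).toNat, by omega⟩
    have h1 := qP_ne hq1 n
    have h2 := qP_ne hq1 m
    have h3 : (1 - q ^ (n + 1)) ≠ 0 := fun h => hq1 (n + 1) (by omega) (sub_eq_zero.mp h).symm
    have h4 : (1 - q ^ (m + 1)) ≠ 0 := fun h => hq1 (m + 1) (by omega) (sub_eq_zero.mp h).symm
    unfold qB
    rw [if_pos (by push_cast; omega), if_pos (by push_cast; omega), if_pos (by push_cast; omega)]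
    have e1 : ((m : ℤ) + 1 + (n + 1 : ℕ)).toNat = (m + n + 1) + 1 := by omega
    have e2 : ((n + 1 : ℕ) : ℤ).toNat = n + 1 := by omega
    have e3 : ((m : ℤ) + 1 + (n + 1 : ℕ) - (n + 1 : ℕ)).toNat = m + 1 := by omega
    have e4 : ((m : ℤ) + 1 - 1 + (n + 1 : ℕ)).toNat = m + n + 1 := by omega
    have e5 : ((m : ℤ) + 1 - 1 + (n + 1 : ℕ) - (n + 1 : ℕ)).toNat = m := by omega
    have e6 : ((m : ℤ) + 1 + n).toNat = m + n + 1 := by omega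
    have e7 : ((n : ℕ) : ℤ).toNat = n := by omega
    have e8 : ((m : ℤ) + 1 + n - n).toNat = m + 1 := by omega
    have e9 : q ^ ((m : ℤ) + 1) = q ^ (m + 1) := by exact_mod_cast zpow_natCast q (m + 1)
    rw [e1, e2, e3, e4, e5, e6, e7, e8, e9, qP_succ q (m + n + 1), qP_succ q n, qP_succ q m]
    field_simp
    ring

/-! ### The fermionic side -/

/-- graded version of `F` -/
def ff {F : Type*} [Field F] (q : F) : ℕ → ℕ → ℕ → ℤ → ℤ → F
  | 0, _, _, _, D => if D = 0 then 1 else 0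
  | ν + 1, s, b, L, D => ∑ n ∈ Finset.range (D.toNat + 1),
      q ^ (-((ν : ℤ) + 1) * n ^ 2 + ((ν : ℤ) + 1 - s + 2 * D) * n) *
        qB q ((n : ℤ) + ((ν : ℤ) + 1) * L - 2 * D - 2 * ((ν : ℤ) + 1) + s + b) n *
        ff q ν (min s ν) (min b ν) (L - 2 * n) (D - ((ν : ℤ) + 1) * n)

lemma ff_neg {F : Type*} [Field F] (q : F) (ν s b : ℕ) (L D : ℤ) (hD : D < 0) :
    ff q ν s b L D = 0 := by
  induction ν generalizing s b L D with
  | zero => simp [ff]; omega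
  | succ ν ih =>
    rw [ff]
    apply Finset.sum_eq_zero
    intro n _
    rw [ih]
    · simp
    · nlinarith

lemma ff_succ {F : Type*} [Field F] (q : F) (ν s b : ℕ) (L D : ℤ) (N : ℕ) (hN : D < N) :
    ff q (ν + 1) s b L D = ∑ n ∈ Finset.range N,
      q ^ (-((ν : ℤ) + 1) * n ^ 2 + ((ν : ℤ) + 1 - s + 2 * D) * n) *
        qB q ((n : ℤ) + ((ν : ℤ) + 1) * L - 2 * D - 2 * ((ν : ℤ) + 1) + s + b) n *
        ff q ν (min s ν) (min b ν) (L - 2 * n) (D - ((ν : ℤ) + 1) * n) := by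
  rcases lt_or_ge D 0 with h | h
  · rw [ff_neg q _ _ _ _ _ h]
    symm
    apply Finset.sum_eq_zero
    intro n _
    rw [ff_neg]
    · simp
    · nlinarith
  · rw [ff]
    apply Finset.sum_subset
    · intro n hn
      simp only [Finset.mem_range] at hn ⊢
      omega
    · intro n _ hn
      simp only [Finset.mem_range] at hn
      have : D < n := by omega
      rw [ff_neg]
      · simp
      · nlinarith

lemma ff_deg {F : Type*} [Field F] (q : F) (ν s b : ℕ) (L D : ℤ)
    (h : (ν : ℤ) * L - 2 * ν + s + b < 2 * D) : ff q ν s b L D = 0 := by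
  rcases lt_or_ge D 0 with hD | hD
  · exact ff_neg q _ _ _ _ _ hD
  cases ν with
  | zero =>
    simp only [ff]
    rw [if_neg]
    push_cast at h
    omega
  | succ ν =>
    rw [ff]
    apply Finset.sum_eq_zero
    intro n _
    rw [qB_eq_zero]
    · simp
    · push_cast at h
      linarith

lemma ff_one {F : Type*} [Field F] {q : F} (hq1 : ∀ n : ℕ, 0 < n → q ^ n ≠ 1)
    (ν s b : ℕ) (hs : s ≤ ν) (hb : b ≤ ν) (D : ℤ) :
    ff q ν s b 1 D = if D = 0 ∧ ν ≤ s + b then 1 else 0 := by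
  induction ν generalizing s b D with
  | zero => simp [ff]
  | succ ν ih =>
    rw [ff, Finset.sum_range_succ', Finset.sum_eq_zero]
    · push_cast
      rw [show D - ((ν : ℤ) + 1) * 0 = D by ring, qB_zero hq1, ih _ _ (min_le_right _ _) (min_le_right _ _)]
      rcases eq_or_ne D 0 with h0 | h0
      · subst h0
        by_cases h1 : ν + 1 ≤ s + b
        · rw [if_pos (by push_cast; omega), if_pos ⟨rfl, by omega⟩, if_pos ⟨rfl, h1⟩]
          simp
        · rw [if_neg (by push_cast; omega), if_neg (c := _ ∧ ν + 1 ≤ s + b) (by tauto)]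
          simp
      · rw [if_neg (c := D = 0 ∧ ν ≤ _) (by tauto), if_neg (c := D = 0 ∧ ν + 1 ≤ _) (by tauto)]
        simp
    · intro n _
      rcases lt_or_ge (D - ((ν : ℤ) + 1) * (n + 1 : ℕ)) 0 with h | h
      · rw [ff_neg q _ _ _ _ _ h]
        simp
      · rw [qB_eq_zero]
        · simp
        · push_cast at h ⊢
          have h2 : (s : ℤ) ≤ ν + 1 := by exact_mod_cast hs
          have h3 : (b : ℤ) ≤ ν + 1 := by exact_mod_cast hb
          nlinarith [mul_nonneg (Int.natCast_nonneg ν) (Int.natCast_nonneg n)]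

lemma ff_zero_rec {F : Type*} [Field F] (q : F) (ν s : ℕ) (L D : ℤ) :
    ff q ν s 0 (L + 1) D = ff q ν s ν L D := by
  induction ν generalizing s L D with
  | zero => simp [ff]
  | succ ν ih =>
    rw [ff, ff]
    apply Finset.sum_congr rfl
    intro n _
    have := ih (min s ν) (L - 2 * n) (D - ((ν : ℤ) + 1) * n)
    rw [show L + 1 - 2 * (n : ℤ) = L - 2 * n + 1 by ring, Nat.zero_min, this,
      Nat.min_eq_right (Nat.le_succ ν)]
    congr 3
    push_cast
    ring

/-- extension of `ff` to integer `b`, zero for negative `b`, clamped at `ν` -/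
def fe {F : Type*} [Field F] (q : F) (ν s : ℕ) (b : ℤ) (L D : ℤ) : F :=
  if b < 0 then 0 else ff q ν s (min b.toNat ν) L D

lemma fe_succ {F : Type*} [Field F] (q : F) (μ s : ℕ) (b L D : ℤ) (N : ℕ) (hN : D < N)
    (hb0 : 0 ≤ b) (hb : b ≤ μ + 1) :
    fe q (μ + 1) s b L D = ∑ n ∈ Finset.range N,
      q ^ (-((μ : ℤ) + 1) * n ^ 2 + ((μ : ℤ) + 1 - s + 2 * D) * n) *
        qB q ((n : ℤ) + ((μ : ℤ) + 1) * L - 2 * D - 2 * ((μ : ℤ) + 1) + s + b) n *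
        fe q μ (min s μ) b (L - 2 * n) (D - ((μ : ℤ) + 1) * n) := by
  obtain ⟨b', rfl⟩ := Int.eq_ofNat_of_zero_le hb0
  have hb' : b' ≤ μ + 1 := by exact_mod_cast hb
  unfold fe
  simp only [if_neg (not_lt.mpr hb0), Int.toNat_natCast]
  rw [Nat.min_eq_left hb', ff_succ q μ s b' L D N hN]

/-- the recurrence at level `μ` -/
def RecAt {F : Type*} [Field F] (q : F) (μ : ℕ) : Prop :=
  ∀ s : ℕ, s ≤ μ → ∀ b : ℤ, 1 ≤ b → b ≤ μ → ∀ L : ℤ, 1 ≤ L → ∀ D : ℤ,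
    fe q μ s b (L + 1) D - fe q μ s (b - 1) (L + 1) D
      = q ^ (L * b) * fe q μ s (μ - b) L (D - b)

lemma rec_plus {F : Type*} [Field F] {q : F} (hq1 : ∀ n : ℕ, 0 < n → q ^ n ≠ 1) (μ : ℕ)
    (hR : RecAt q μ) (s : ℕ) (hs : s ≤ μ + 1) (b : ℤ) (hb0 : 0 ≤ b) (hb : b ≤ μ + 1)
    (M d : ℤ) (hc : 0 ≤ ((μ : ℤ) + 1) * (M - 1) + s + b - 2 * d) :
    fe q μ (min s μ) b (M + 1) d - fe q μ (min s μ) (b - 1) (M + 1) d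
      = q ^ (M * b) * fe q μ (min s μ) (μ - b) M (d - b) := by
  rcases eq_or_lt_of_le hb0 with h | h
  · subst h
    simp only [fe]
    rw [if_neg (by omega), if_pos (by omega), if_neg (by omega)]
    simp [ff_zero_rec]
  rcases eq_or_lt_of_le hb with h' | h'
  · subst h'
    simp only [fe]
    rw [if_neg (by omega), if_neg (by omega), if_pos (by omega)]
    rw [show min ((μ : ℤ) + 1).toNat μ = μ by omega, show min ((μ : ℤ) + 1 - 1).toNat μ = μ by omega]
    simp
  have hb1 : b ≤ μ := by omega
  rcases lt_trichotomy M 0 with hM | hM | hM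
  · have hd : d < 0 := by
      have : (s : ℤ) ≤ μ + 1 := by exact_mod_cast hs
      nlinarith
    have z : ∀ b' L' d', d' < 0 → fe q μ (min s μ) b' L' d' = 0 := by
      intro b' L' d' hd'
      unfold fe
      split_ifs
      · rfl
      · exact ff_neg _ _ _ _ _ _ hd'
    rw [z _ _ _ hd, z _ _ _ hd, z _ _ _ (by omega)]
    simp
  · subst hM
    obtain ⟨b', rfl⟩ := Int.eq_ofNat_of_zero_le hb0
    have z : fe q μ (min s μ) (μ - b') 0 (d - b') = 0 := by
      unfold fe
      split_ifs with h1
      · rfl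
      · rcases lt_or_ge (d - b') 0 with h2 | h2
        · exact ff_neg _ _ _ _ _ _ h2
        · apply ff_deg
          rw [show min ((μ : ℤ) - b').toNat μ = μ - b' by omega]
          omega
    rw [z]
    rcases lt_or_ge d 0 with h2 | h2
    · unfold fe
      rw [if_neg (by omega), if_neg (by omega), ff_neg _ _ _ _ _ _ h2, ff_neg _ _ _ _ _ _ h2]
      simp
    · unfold fe
      rw [if_neg (by omega), if_neg (by omega), zero_add, ff_one hq1 _ _ _ (by omega) (by omega),
        ff_one hq1 _ _ _ (by omega) (by omega)]
      rw [sub_eq_zero.mpr]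
      · simp
      · apply if_congr _ rfl rfl
        constructor
        · rintro ⟨h3, h4⟩
          refine ⟨h3, ?_⟩
          omega
        · rintro ⟨h3, h4⟩
          refine ⟨h3, ?_⟩
          omega
  · exact hR _ (min_le_right _ _) b (by omega) hb1 M (by omega) d

lemma rec_all {F : Type*} [Field F] {q : F} (hq : q ≠ 0) (hq1 : ∀ n : ℕ, 0 < n → q ^ n ≠ 1)
    (μ : ℕ) : RecAt q μ := by
  induction μ with
  | zero => intro s _ b h1 h2; push_cast at h2; omega
  | succ μ ih =>
    intro s hs b hb1 hb L hL D
    push_cast at hb ⊢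
    have RP := rec_plus hq1 μ ih s hs
    set N : ℕ := D.toNat + 1 with hN
    have hDN : D < N := by omega
    rw [fe_succ q μ s b (L + 1) D (N + 1) (by push_cast; omega) (by omega) hb,
      fe_succ q μ s (b - 1) (L + 1) D (N + 1) (by push_cast; omega) (by omega) (by omega),
      fe_succ q μ s ((μ : ℤ) + 1 - b) L (D - b) N (by omega) (by omega) (by omega)]
    set c : ℤ := ((μ : ℤ) + 1) * (L + 1) - 2 * D - 2 * ((μ : ℤ) + 1) + s with hcdef
    set e : ℕ → ℤ := fun n => -((μ : ℤ) + 1) * n ^ 2 + ((μ : ℤ) + 1 - s + 2 * D) * n with he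
    set f : ℤ → ℤ → ℤ → F := fe q μ (min s μ) with hf
    have fneg : ∀ b' L' d', d' < 0 → f b' L' d' = 0 := by
      intro b' L' d' hd'
      simp only [hf]
      unfold fe
      split_ifs
      · rfl
      · exact ff_neg _ _ _ _ _ _ hd'
    set P : ℕ → F := fun n => q ^ e n * qB q (c + b + n) n *
      (f b (L + 1 - 2 * n) (D - ((μ : ℤ) + 1) * n) - f (b - 1) (L + 1 - 2 * n) (D - ((μ : ℤ) + 1) * n))
      with hP
    set T : ℕ → F := fun n => q ^ e n * (qB q (c + b + n) n - qB q (c + b - 1 + n) n) *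
      f (b - 1) (L + 1 - 2 * n) (D - ((μ : ℤ) + 1) * n) with hT
    rw [← Finset.sum_sub_distrib]
    have step1 : ∀ n ∈ Finset.range (N + 1),
        (q ^ (-((μ : ℤ) + 1) * n ^ 2 + ((μ : ℤ) + 1 - s + 2 * D) * n) *
        qB q ((n : ℤ) + ((μ : ℤ) + 1) * (L + 1) - 2 * D - 2 * ((μ : ℤ) + 1) + s + b) n *
        f b (L + 1 - 2 * n) (D - ((μ : ℤ) + 1) * n) -
        q ^ (-((μ : ℤ) + 1) * n ^ 2 + ((μ : ℤ) + 1 - s + 2 * D) * n) *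
        qB q ((n : ℤ) + ((μ : ℤ) + 1) * (L + 1) - 2 * D - 2 * ((μ : ℤ) + 1) + s + (b - 1)) n *
        f (b - 1) (L + 1 - 2 * n) (D - ((μ : ℤ) + 1) * n)) = P n + T n := by
      intro n _
      simp only [hP, hT, he]
      rw [show (n : ℤ) + ((μ : ℤ) + 1) * (L + 1) - 2 * D - 2 * ((μ : ℤ) + 1) + s + b = c + b + n by
        rw [hcdef]; ring,
        show (n : ℤ) + ((μ : ℤ) + 1) * (L + 1) - 2 * D - 2 * ((μ : ℤ) + 1) + s + (b - 1)
          = c + b - 1 + n by rw [hcdef]; ring]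
      ring
    rw [Finset.sum_congr rfl step1, Finset.sum_add_distrib, Finset.sum_range_succ P,
      Finset.sum_range_succ' T]
    have PN : P N = 0 := by
      simp only [hP]
      have : D - ((μ : ℤ) + 1) * N < 0 := by nlinarith
      rw [fneg _ _ _ this, fneg _ _ _ this]
      simp
    have T0 : T 0 = 0 := by
      simp only [hT]
      push_cast
      rw [add_zero, add_zero, qB_zero hq1, qB_zero hq1]
      by_cases h : c + b = 0
      · have : f (b - 1) (L + 1 - 0) (D - ((μ : ℤ) + 1) * 0) = 0 := by
          simp only [hf]
          unfold fe
          rw [if_neg (by omega)]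
          apply ff_deg
          have h1 : ((min s μ : ℕ) : ℤ) ≤ s := by omega
          have h2 : ((min (b - 1).toNat μ : ℕ) : ℤ) ≤ b - 1 := by omega
          have h3 : c + b = ((μ : ℤ) + 1) * (L + 1) - 2 * D - 2 * ((μ : ℤ) + 1) + s + b := by
            rw [hcdef]
          nlinarith
        rw [this]
        simp
      · have : (0 ≤ c + b) ↔ (0 ≤ c + b - 1) := by omega
        simp [this]
    rw [PN, T0, add_zero, add_zero, ← Finset.sum_add_distrib, Finset.mul_sum]
    apply Finset.sum_congr rfl
    intro n _
    have hC : (n : ℤ) + ((μ : ℤ) + 1) * L - 2 * (D - b) - 2 * ((μ : ℤ) + 1) + s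
        + ((μ : ℤ) + 1 - b) = c + b + n := by rw [hcdef]; ring
    rw [hC]
    simp only [hP, hT]
    have e1 : c + b - 1 + ((n + 1 : ℕ) : ℤ) = (c + b) - 1 + ((n + 1 : ℕ) : ℤ) := by ring
    rw [qB_pascal hq1]
    rcases lt_or_ge (c + b) 0 with hcb | hcb
    · rw [qB_eq_zero q (show c + b + n < n by omega)]
      simp
    have R1 := RP b (by omega) hb (L - 2 * n) (D - ((μ : ℤ) + 1) * n) (by
      rw [hcdef] at hcb; linarith)
    have R2 := RP ((μ : ℤ) + 1 - b) (by omega) (by omega) (L - 2 * n - 1)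
      (D - b - ((μ : ℤ) + 1) * n) (by rw [hcdef] at hcb; linarith)
    rw [show L - 2 * (n : ℤ) + 1 = L + 1 - 2 * n by ring] at R1
    rw [show L - 2 * (n : ℤ) - 1 + 1 = L - 2 * n by ring, sub_eq_iff_eq_add] at R2
    rw [show (L + 1 - 2 * ((n + 1 : ℕ) : ℤ)) = L - 2 * n - 1 by push_cast; ring,
      show D - ((μ : ℤ) + 1) * ((n + 1 : ℕ) : ℤ) = D - b - ((μ : ℤ) + 1) * n - ((μ : ℤ) + 1 - b) by
        push_cast; ring, R1, R2,
      show (μ : ℤ) - ((μ : ℤ) + 1 - b) = b - 1 by ring,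
      show (μ : ℤ) + 1 - b - 1 = μ - b by ring,
      show D - ((μ : ℤ) + 1) * (n : ℤ) - b = D - b - ((μ : ℤ) + 1) * n by ring]
    set y1 := fe q μ (min s μ) (μ - b) (L - 2 * n) (D - b - ((μ : ℤ) + 1) * n)
    set y2 := fe q μ (min s μ) (b - 1) (L - 2 * n - 1)
      (D - b - ((μ : ℤ) + 1) * n - ((μ : ℤ) + 1 - b))
    have E1 : q ^ e n * q ^ ((L - 2 * (n : ℤ)) * b) = q ^ (L * b) *
        q ^ (-((μ : ℤ) + 1) * n ^ 2 + ((μ : ℤ) + 1 - s + 2 * (D - b)) * n) := by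
      simp only [← zpow_add₀ hq, he]
      congr 1
      ring
    have E2 : q ^ e (n + 1) * q ^ (c + b) = q ^ (L * b) *
        q ^ (-((μ : ℤ) + 1) * n ^ 2 + ((μ : ℤ) + 1 - s + 2 * (D - b)) * n) *
        q ^ ((L - 2 * (n : ℤ) - 1) * ((μ : ℤ) + 1 - b)) := by
      simp only [← zpow_add₀ hq, he, hcdef]
      congr 1
      push_cast
      ring
    have h2 : ∀ x : F, f (b - 1) (L - 2 * n - 1)
      (D - b - ((μ : ℤ) + 1) * n - ((μ : ℤ) + 1 - b)) = y2 := fun _ => rfl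
    rw [h2 0]
    linear_combination (qB q (c + b + n) n * y1) * E1 + (qB q (c + b + n) n * y2) * E2

/-! ### From `Fpoly` to the graded version -/

lemma finsum_swap {α β M : Type*} [AddCommMonoid M] (f : α → β → M)
    (h : (Function.support (fun p : α × β => f p.1 p.2)).Finite) :
    ∑ᶠ a, ∑ᶠ b, f a b = ∑ᶠ b, ∑ᶠ a, f a b := by
  have h1 := finsum_curry (fun p : α × β => f p.1 p.2) h
  have h2 := finsum_curry (fun p : β × α => f p.2 p.1) (by
    refine (h.image Prod.swap).subset ?_
    rintro ⟨x, y⟩ hxy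
    exact ⟨(y, x), hxy, rfl⟩)
  rw [← h1, ← h2]
  exact (finsum_comp_equiv (Equiv.prodComm α β) (f := fun p : β × α => f p.2 p.1))

/-- summand of `Fpoly` with integer `L` -/
def tt {F : Type*} [Field F] (q : F) (ν s b : ℕ) (L : ℤ) (nn : Fin ν → ℕ) : F :=
  q ^ expAG ν s nn *
    ∏ i : Fin ν, qB q ((nn i : ℤ) + ((i : ℕ) + 1) * L -
      2 * (∑ l ∈ Finset.Icc 1 ((i : ℕ) + 1), (NN nn l : ℤ)) -
      alph ((i : ℕ) + 1) s - alph ((i : ℕ) + 1) b) (nn i)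

/-- total degree -/
def dg {ν : ℕ} (nn : Fin ν → ℕ) : ℕ := ∑ i ∈ Finset.Icc 1 ν, NN nn i

lemma NN_snoc {ν : ℕ} (nn : Fin ν → ℕ) (n i : ℕ) (hi : i ≤ ν + 1) :
    NN (Fin.snoc nn n : Fin (ν + 1) → ℕ) i = NN nn i + n := by
  unfold NN
  rw [Fin.sum_univ_castSucc]
  simp [hi]

lemma NN_top {ν : ℕ} (nn : Fin ν → ℕ) : NN nn (ν + 1) = 0 := by
  unfold NN
  apply Finset.sum_eq_zero
  intro k _
  rw [if_neg]
  have := k.2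
  omega

lemma le_NN {ν : ℕ} (nn : Fin ν → ℕ) (k : Fin ν) : nn k ≤ NN nn 1 := by
  unfold NN
  have := Finset.single_le_sum (f := fun k : Fin ν => if 1 ≤ (k : ℕ) + 1 then nn k else 0)
    (fun _ _ => Nat.zero_le _) (Finset.mem_univ k)
  simpa using this

lemma NN_le_dg {ν : ℕ} (hν : 1 ≤ ν) (nn : Fin ν → ℕ) : NN nn 1 ≤ dg nn := by
  unfold dg
  exact Finset.single_le_sum (f := fun i => NN nn i)
    (fun _ _ => Nat.zero_le _) (Finset.mem_Icc.mpr ⟨le_rfl, hν⟩)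

lemma bdd_fin (ν N : ℕ) (S : Set (Fin ν → ℕ)) (h : ∀ nn ∈ S, ∀ k, nn k ≤ N) : S.Finite := by
  refine (Set.Finite.pi' (fun _ : Fin ν => Set.finite_Iic N)).subset ?_
  intro nn hnn k
  exact h nn hnn k

lemma dg_fin (ν : ℕ) (D : ℤ) : {nn : Fin ν → ℕ | (dg nn : ℤ) = D}.Finite := by
  apply bdd_fin ν D.toNat
  intro nn hnn k
  have h1 := le_NN nn k
  have h2 := NN_le_dg (by have := k.2; omega) nn
  simp only [Set.mem_ofPred_eq] at hnn
  omega

lemma dg_snoc {ν : ℕ} (nn : Fin ν → ℕ) (n : ℕ) :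
    dg (Fin.snoc nn n : Fin (ν + 1) → ℕ) = dg nn + (ν + 1) * n := by
  unfold dg
  rw [Finset.sum_congr rfl (fun i hi => NN_snoc nn n i (Finset.mem_Icc.mp hi).2),
    Finset.sum_add_distrib, Finset.sum_Icc_succ_top (by omega), NN_top]
  simp

lemma expAG_snoc {ν : ℕ} (s : ℕ) (hs : s ≤ ν + 1) (nn : Fin ν → ℕ) (n : ℕ) :
    (expAG (ν + 1) s (Fin.snoc nn n : Fin (ν + 1) → ℕ) : ℤ) = expAG ν (min s ν) nn +
      (((ν : ℤ) + 1) * n ^ 2 + 2 * n * dg nn + ((ν : ℤ) + 1 - s) * n) := by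
  unfold expAG dg
  have h1 : ∑ i ∈ Finset.Icc 1 (ν + 1), (NN (Fin.snoc nn n : Fin (ν + 1) → ℕ) i) ^ 2
      = ∑ i ∈ Finset.Icc 1 ν, (NN nn i) ^ 2 + 2 * n * ∑ i ∈ Finset.Icc 1 ν, NN nn i
        + (ν + 1) * n ^ 2 := by
    rw [Finset.sum_congr rfl (fun i hi => by rw [NN_snoc nn n i (Finset.mem_Icc.mp hi).2, add_sq]),
      Finset.sum_add_distrib, Finset.sum_add_distrib, Finset.sum_Icc_succ_top (by omega),
      Finset.sum_Icc_succ_top (by omega), NN_top]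
    rw [Finset.mul_sum]
    simp
    apply Finset.sum_congr rfl
    intro i _
    ring
  have h2 : ∑ i ∈ Finset.Icc (s + 1) (ν + 1), NN (Fin.snoc nn n : Fin (ν + 1) → ℕ) i
      = ∑ i ∈ Finset.Icc (min s ν + 1) ν, NN nn i + (ν + 1 - s) * n := by
    rw [Finset.sum_congr rfl (fun i hi => NN_snoc nn n i (Finset.mem_Icc.mp hi).2),
      Finset.sum_add_distrib]
    simp only [Finset.sum_const, Nat.card_Icc, smul_eq_mul]
    congr 1
    · rcases Nat.lt_or_ge ν s with h | h
      · rw [Nat.min_eq_right h.le, Finset.Icc_eq_empty (by omega), Finset.Icc_eq_empty (by omega)]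
      · rw [Nat.min_eq_left h, Finset.sum_Icc_succ_top (by omega), NN_top, add_zero]
    · congr 1
      omega
  rw [h1, h2]
  push_cast [Nat.cast_sub hs]
  ring

lemma alph_min (i s ν : ℕ) (hi : i ≤ ν) : alph i (min s ν) = alph i s := by
  unfold alph
  omega

lemma tt_snoc {F : Type*} [Field F] {q : F} (hq : q ≠ 0) (ν s b : ℕ) (hs : s ≤ ν + 1)
    (hb : b ≤ ν + 1) (L : ℤ) (nn : Fin ν → ℕ) (n : ℕ) :
    tt q (ν + 1) s b L (Fin.snoc nn n : Fin (ν + 1) → ℕ) =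
      (q ^ (-((ν : ℤ) + 1) * n ^ 2 + ((ν : ℤ) + 1 - s + 2 * (dg nn + ((ν : ℤ) + 1) * n)) * n) *
        qB q ((n : ℤ) + ((ν : ℤ) + 1) * L - 2 * (dg nn + ((ν : ℤ) + 1) * n)
          - 2 * ((ν : ℤ) + 1) + s + b) n) *
        tt q ν (min s ν) (min b ν) (L - 2 * n) nn := by
  unfold tt
  rw [Fin.prod_univ_castSucc, ← zpow_natCast q, expAG_snoc s hs, ← zpow_natCast q (expAG ν _ nn),
    zpow_add₀ hq]
  have hl : ((Fin.snoc nn n : Fin (ν + 1) → ℕ) (Fin.last ν) : ℤ) + (((Fin.last ν : Fin (ν + 1)) : ℕ) + 1) * L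
      - 2 * (∑ l ∈ Finset.Icc 1 (((Fin.last ν : Fin (ν + 1)) : ℕ) + 1),
        (NN (Fin.snoc nn n : Fin (ν + 1) → ℕ) l : ℤ)) -
      alph (((Fin.last ν : Fin (ν + 1)) : ℕ) + 1) s - alph (((Fin.last ν : Fin (ν + 1)) : ℕ) + 1) b
      = (n : ℤ) + ((ν : ℤ) + 1) * L - 2 * (dg nn + ((ν : ℤ) + 1) * n)
          - 2 * ((ν : ℤ) + 1) + s + b := by
    have h := dg_snoc nn n
    simp only [Fin.snoc_last, Fin.val_last]
    have h' : (∑ l ∈ Finset.Icc 1 (ν + 1), (NN (Fin.snoc nn n : Fin (ν + 1) → ℕ) l : ℤ))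
        = dg nn + ((ν : ℤ) + 1) * n := by
      unfold dg at h
      have := congrArg (Nat.cast : ℕ → ℤ) h
      push_cast at this
      unfold dg
      push_cast
      exact this
    rw [h']
    have a1 : alph (ν + 1) s = (ν : ℤ) + 1 - s := by unfold alph; push_cast; omega
    have a2 : alph (ν + 1) b = (ν : ℤ) + 1 - b := by unfold alph; push_cast; omega
    rw [a1, a2]
    ring
  have hc : ∀ i : Fin ν, ((Fin.snoc nn n : Fin (ν + 1) → ℕ) i.castSucc : ℤ) + (((i.castSucc : Fin (ν + 1)) : ℕ) + 1) * L
      - 2 * (∑ l ∈ Finset.Icc 1 (((i.castSucc : Fin (ν + 1)) : ℕ) + 1),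
        (NN (Fin.snoc nn n : Fin (ν + 1) → ℕ) l : ℤ)) -
      alph (((i.castSucc : Fin (ν + 1)) : ℕ) + 1) s - alph (((i.castSucc : Fin (ν + 1)) : ℕ) + 1) b
      = (nn i : ℤ) + ((i : ℕ) + 1) * (L - 2 * n) -
      2 * (∑ l ∈ Finset.Icc 1 ((i : ℕ) + 1), (NN nn l : ℤ)) -
      alph ((i : ℕ) + 1) (min s ν) - alph ((i : ℕ) + 1) (min b ν) := by
    intro i
    have hi := i.2
    rw [alph_min _ _ _ (by omega), alph_min _ _ _ (by omega)]
    simp only [Fin.snoc_castSucc, Fin.val_castSucc]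
    rw [Finset.sum_congr rfl (fun l hl => by
      rw [NN_snoc nn n l (by have := (Finset.mem_Icc.mp hl).2; omega), Nat.cast_add]),
      Finset.sum_add_distrib]
    simp
    ring
  simp only [hc, hl]
  simp only [Fin.snoc_castSucc, Fin.snoc_last]
  rw [show -((ν : ℤ) + 1) * n ^ 2 + ((ν : ℤ) + 1 - s + 2 * (dg nn + ((ν : ℤ) + 1) * n)) * n
    = ((ν : ℤ) + 1) * n ^ 2 + 2 * n * dg nn + ((ν : ℤ) + 1 - s) * n by ring]
  ring

lemma ff_eq {F : Type*} [Field F] {q : F} (hq : q ≠ 0) (ν s b : ℕ) (hs : s ≤ ν)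
    (hb : b ≤ ν) (L D : ℤ) :
    ff q ν s b L D = ∑ᶠ nn : Fin ν → ℕ, if (dg nn : ℤ) = D then tt q ν s b L nn else 0 := by
  induction ν generalizing s b L D with
  | zero =>
    rw [finsum_unique]
    simp [ff, tt, expAG, dg, eq_comm]
  | succ ν ih =>
    rw [← finsum_comp_equiv (Fin.snocEquiv (fun _ : Fin (ν + 1) => ℕ))]
    rw [finsum_curry]
    · have key : ∀ n : ℕ, ∑ᶠ nn : Fin ν → ℕ,
          (if (dg (Fin.snocEquiv (fun _ : Fin (ν + 1) => ℕ) (n, nn)) : ℤ) = D then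
            tt q (ν + 1) s b L (Fin.snocEquiv (fun _ : Fin (ν + 1) => ℕ) (n, nn)) else 0)
          = q ^ (-((ν : ℤ) + 1) * n ^ 2 + ((ν : ℤ) + 1 - s + 2 * D) * n) *
        qB q ((n : ℤ) + ((ν : ℤ) + 1) * L - 2 * D - 2 * ((ν : ℤ) + 1) + s + b) n *
        ff q ν (min s ν) (min b ν) (L - 2 * n) (D - ((ν : ℤ) + 1) * n) := by
        intro n
        rw [ih _ _ (min_le_right _ _) (min_le_right _ _), mul_finsum]
        · apply finsum_congr
          intro nn
          have e : (Fin.snocEquiv (fun _ : Fin (ν + 1) => ℕ) (n, nn)) = (Fin.snoc nn n : Fin (ν + 1) → ℕ) := rfl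
          rw [e, dg_snoc, tt_snoc hq ν s b hs hb]
          by_cases h : (dg nn : ℤ) = D - ((ν : ℤ) + 1) * n
          · rw [if_pos h, if_pos (by push_cast; linarith)]
            rw [show (dg nn : ℤ) + ((ν : ℤ) + 1) * n = D by linarith]
          · rw [if_neg h, if_neg (by push_cast; intro h'; apply h; linarith), mul_zero]
      rw [finsum_congr key, ff]
      symm
      apply finsum_eq_sum_of_support_subset
      intro n hn
      simp only [Finset.coe_range, Set.mem_Iio]
      by_contra h
      apply hn
      beta_reduce
      rw [ff_neg]
      · simp
      · have : D < n := by omega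
        nlinarith
    · refine Set.Finite.subset (Set.Finite.preimage
        (Fin.snocEquiv (fun _ : Fin (ν + 1) => ℕ)).injective.injOn (dg_fin (ν + 1) D)) ?_
      intro p hp
      by_contra h
      exact hp (if_neg h)

lemma tt_bdd {F : Type*} [Field F] (q : F) (ν s b : ℕ) (L : ℕ) (nn : Fin ν → ℕ)
    (h : tt q ν s b L nn ≠ 0) (k : Fin ν) : nn k ≤ L := by
  unfold tt at h
  have h1 := right_ne_zero_of_mul h
  rw [Finset.prod_ne_zero_iff] at h1
  have hν : 0 < ν := by have := k.2; omega
  have h2 := h1 ⟨0, hν⟩ (Finset.mem_univ _)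
  have h3 : ¬ _ := fun hh => h2 (qB_eq_zero q hh)
  have h4 := le_NN nn k
  have a1 : 0 ≤ alph 1 s := le_max_left _ _
  have a2 : 0 ≤ alph 1 b := le_max_left _ _
  simp at h3
  omega

lemma Fpoly_eq {F : Type*} [Field F] {q : F} (hq : q ≠ 0) (ν s b : ℕ) (hs : s ≤ ν)
    (hb : b ≤ ν) (L : ℕ) :
    Fpoly ν s b L q = ∑ᶠ D : ℤ, ff q ν s b L D := by
  rw [finsum_congr (ff_eq hq ν s b hs hb L), finsum_swap]
  · unfold Fpoly
    apply finsum_congr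
    intro nn
    rw [finsum_eq_single _ (dg nn : ℤ) (fun D hD => if_neg (Ne.symm hD)), if_pos rfl]
    rfl
  · have hfin : {nn : Fin ν → ℕ | tt q ν s b L nn ≠ 0}.Finite :=
      bdd_fin ν L _ (fun nn hnn k => tt_bdd q ν s b L nn hnn k)
    refine (hfin.image (fun nn => ((dg nn : ℤ), nn))).subset ?_
    rintro ⟨D, nn⟩ hp
    simp only [Function.mem_support, ne_eq, ite_eq_right_iff, Classical.not_imp] at hp
    exact ⟨nn, hp.2, by rw [← hp.1]⟩

lemma ff_supp {F : Type*} [Field F] (q : F) (ν s b : ℕ) (L : ℤ) :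
    (Function.support (fun D : ℤ => ff q ν s b L D)).Finite := by
  refine (Set.finite_Icc 0 ((ν : ℤ) * L - 2 * ν + s + b)).subset ?_
  intro D hD
  rw [Set.mem_Icc]
  by_contra h
  rw [not_and_or] at h
  rcases h with h | h
  · exact hD (ff_neg _ _ _ _ _ _ (by omega))
  · rcases lt_or_ge D 0 with h1 | h1
    · exact hD (ff_neg _ _ _ _ _ _ h1)
    · exact hD (ff_deg _ _ _ _ _ _ (by omega))

lemma Fpoly_rec0 {F : Type*} [Field F] {q : F} (hq : q ≠ 0) (ν s : ℕ) (hs : s ≤ ν) (L : ℕ) :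
    Fpoly ν s 0 (L + 1) q = Fpoly ν s ν L q := by
  rw [Fpoly_eq hq ν s 0 hs (Nat.zero_le _), Fpoly_eq hq ν s ν hs le_rfl]
  apply finsum_congr
  intro D
  push_cast
  exact ff_zero_rec q ν s L D

lemma Fpoly_rec {F : Type*} [Field F] {q : F} (hq : q ≠ 0) (hq1 : ∀ n : ℕ, 0 < n → q ^ n ≠ 1)
    (ν s : ℕ) (hs : s ≤ ν) (b : ℕ) (hb : b + 1 ≤ ν) (L : ℕ) (hL : 1 ≤ L) :
    Fpoly ν s (b + 1) (L + 1) q - Fpoly ν s b (L + 1) q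
      = q ^ (L * (b + 1)) * Fpoly ν s (ν - (b + 1)) L q := by
  rw [Fpoly_eq hq ν s _ hs hb, Fpoly_eq hq ν s _ hs (by omega), Fpoly_eq hq ν s _ hs (by omega),
    ← finsum_sub_distrib (by exact ff_supp _ _ _ _ _) (by exact ff_supp _ _ _ _ _),
    ← finsum_comp_equiv (Equiv.subRight ((b : ℤ) + 1))
      (f := fun D => ff q ν s (ν - (b + 1)) L D), mul_finsum]
  · apply finsum_congr
    intro D
    have h := rec_all hq hq1 ν s hs ((b : ℤ) + 1) (by omega) (by omega) L (by omega) D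
    unfold fe at h
    rw [if_neg (by omega), if_neg (by omega), if_neg (by omega),
      show min ((b : ℤ) + 1).toNat ν = b + 1 by omega,
      show min ((b : ℤ) + 1 - 1).toNat ν = b by omega,
      show min ((ν : ℤ) - ((b : ℤ) + 1)).toNat ν = ν - (b + 1) by omega] at h
    push_cast
    rw [h, ← zpow_natCast q]
    push_cast
    rfl

lemma Fpoly_one {F : Type*} [Field F] {q : F} (hq : q ≠ 0) (hq1 : ∀ n : ℕ, 0 < n → q ^ n ≠ 1)
    (ν s b : ℕ) (hs : s ≤ ν) (hb : b ≤ ν) :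
    Fpoly ν s b 1 q = if ν ≤ s + b then 1 else 0 := by
  rw [Fpoly_eq hq ν s b hs hb, finsum_eq_single _ (0 : ℤ)]
  · push_cast
    rw [ff_one hq1 ν s b hs hb]
    simp
  · intro D hD
    push_cast
    rw [ff_one hq1 ν s b hs hb, if_neg (by tauto)]

/-! ### The bosonic side: weighted sums over integer sequences -/

/-- `1/(q)_n`, zero for negative `n` -/
def iq {F : Type*} [Field F] (q : F) (n : ℤ) : F := if n < 0 then 0 else (qP q n.toNat)⁻¹

lemma iq_rec {F : Type*} [Field F] {q : F} (hq1 : ∀ n : ℕ, 0 < n → q ^ n ≠ 1) (n : ℤ) :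
    (1 - q ^ n) * iq q n = iq q (n - 1) := by
  unfold iq
  rcases lt_trichotomy n 0 with h | h | h
  · rw [if_pos h, if_pos (by omega), mul_zero]
  · subst h
    simp
  · obtain ⟨m, rfl⟩ : ∃ m : ℕ, n = m + 1 := ⟨(n - 1).toNat, by omega⟩
    rw [if_neg (by omega), if_neg (by omega)]
    have e1 : ((m : ℤ) + 1).toNat = m + 1 := by omega
    have e2 : ((m : ℤ) + 1 - 1).toNat = m := by omega
    have e9 : q ^ ((m : ℤ) + 1) = q ^ (m + 1) := by exact_mod_cast zpow_natCast q (m + 1)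
    have h1 := qP_ne hq1 m
    have h4 : (1 - q ^ (m + 1)) ≠ 0 := fun h => hq1 (m + 1) (by omega) (sub_eq_zero.mp h).symm
    rw [e1, e2, e9, qP_succ]
    field_simp

/-- `J 0 = 0`, `J l = j_l`, `J (ν+1) = L` -/
def JJ {ν : ℕ} (L : ℤ) (j : Fin ν → ℤ) (i : ℕ) : ℤ :=
  if i = 0 then 0 else if h : i - 1 < ν then j ⟨i - 1, h⟩ else L

/-- partial sums of `J` -/
def SS {ν : ℕ} (L : ℤ) (j : Fin ν → ℤ) (p : ℕ) : ℤ := ∑ i ∈ Finset.range (p + 1), JJ L j i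

/-- local factor of the weight -/
def fac {F : Type*} [Field F] (q : F) {ν : ℕ} (L : ℤ) (j : Fin ν → ℤ) (i : ℕ) : F :=
  q ^ (JJ L j i * (L - JJ L j (i + 1))) * iq q (JJ L j (i + 1) - JJ L j i)

/-- weight -/
def ww {F : Type*} [Field F] (q : F) {ν : ℕ} (L : ℕ) (j : Fin ν → ℤ) : F :=
  qP q L * ∏ i ∈ Finset.range (ν + 1), fac q (L : ℤ) j i

/-- expectation -/
def EE {F : Type*} [Field F] (q : F) (ν L : ℕ) (φ : (Fin ν → ℤ) → F) (x : ℤ) : F :=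
  ∑ᶠ j : Fin ν → ℤ, if ∑ l, j l = x then ww q L j * φ j else 0

lemma JJ_zero {ν : ℕ} (L : ℤ) (j : Fin ν → ℤ) : JJ L j 0 = 0 := by simp [JJ]

lemma JJ_top {ν : ℕ} (L : ℤ) (j : Fin ν → ℤ) : JJ L j (ν + 1) = L := by simp [JJ]

lemma JJ_fin {ν : ℕ} (L : ℤ) (j : Fin ν → ℤ) (k : Fin ν) : JJ L j ((k : ℕ) + 1) = j k := by
  simp [JJ]

lemma SS_zero {ν : ℕ} (L : ℤ) (j : Fin ν → ℤ) : SS L j 0 = 0 := by simp [SS, JJ]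

lemma SS_succ {ν : ℕ} (L : ℤ) (j : Fin ν → ℤ) (p : ℕ) :
    SS L j (p + 1) = SS L j p + JJ L j (p + 1) := by
  unfold SS
  rw [Finset.sum_range_succ]

lemma SS_nu {ν : ℕ} (L : ℤ) (j : Fin ν → ℤ) : SS L j ν = ∑ l, j l := by
  unfold SS
  rw [Finset.sum_range_succ', JJ_zero, add_zero, ← Fin.sum_univ_eq_sum_range]
  exact Finset.sum_congr rfl (fun k _ => JJ_fin L j k)

lemma JJ_shift {ν : ℕ} (L : ℤ) (j : Fin ν → ℤ) (k : Fin ν) (i : ℕ) :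
    JJ L (j + Pi.single k 1) i = JJ L j i + if i = (k : ℕ) + 1 then 1 else 0 := by
  unfold JJ
  have hk := k.2
  by_cases h0 : i = 0
  · simp [h0]
  · by_cases h : i - 1 < ν
    · simp only [h0, h, if_false, dif_pos, Pi.add_apply, Pi.single_apply]
      congr 1
      apply if_congr _ rfl rfl
      rw [Fin.ext_iff]
      simp only
      omega
    · simp only [h0, h, if_false, dif_neg, not_false_eq_true]
      rw [if_neg (by omega), add_zero]

lemma SS_shift {ν : ℕ} (L : ℤ) (j : Fin ν → ℤ) (k : Fin ν) (p : ℕ) :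
    SS L (j + Pi.single k 1) p = SS L j p + if (k : ℕ) + 1 ≤ p then 1 else 0 := by
  unfold SS
  rw [Finset.sum_congr rfl (fun i _ => JJ_shift L j k i), Finset.sum_add_distrib,
    Finset.sum_ite_eq']
  congr 1
  apply if_congr _ rfl rfl
  simp only [Finset.mem_range]
  omega

lemma ww_supp {F : Type*} [Field F] (q : F) (ν L : ℕ) :
    (Function.support (fun j : Fin ν → ℤ => ww q L j)).Finite := by
  refine (Set.Finite.pi' (fun _ : Fin ν => Set.finite_Icc (0 : ℤ) L)).subset ?_
  intro j hj
  have h1 := right_ne_zero_of_mul hj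
  rw [Finset.prod_ne_zero_iff] at h1
  have step : ∀ i, i ≤ ν → JJ (L : ℤ) j i ≤ JJ (L : ℤ) j (i + 1) := by
    intro i hi
    have h2 := right_ne_zero_of_mul (h1 i (Finset.mem_range.mpr (by omega)))
    unfold iq at h2
    by_contra h3
    exact h2 (if_pos (by omega))
  have up : ∀ i, i ≤ ν + 1 → 0 ≤ JJ (L : ℤ) j i := by
    intro i
    induction i with
    | zero => intro _; rw [JJ_zero]
    | succ i ih => intro hi; exact (ih (by omega)).trans (step i (by omega))
  have down : ∀ m, ∀ i, i + m = ν + 1 → JJ (L : ℤ) j i ≤ L := by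
    intro m
    induction m with
    | zero => intro i hi; rw [show i = ν + 1 by omega, JJ_top]
    | succ m ih => intro i hi; exact (step i (by omega)).trans (ih (i + 1) (by omega))
  intro k
  have hk := k.2
  rw [← JJ_fin (L : ℤ) j k]
  exact ⟨up _ (by omega), down (ν - k) _ (by omega)⟩

lemma EE_supp {F : Type*} [Field F] (q : F) (ν L : ℕ) (φ : (Fin ν → ℤ) → F) (x : ℤ) :
    (Function.support (fun j : Fin ν → ℤ => if ∑ l, j l = x then ww q L j * φ j else 0)).Finite := by
  refine (ww_supp q ν L).subset ?_
  intro j hj h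
  apply hj
  beta_reduce at h ⊢
  rw [h]
  simp

lemma EE_sub {F : Type*} [Field F] (q : F) (ν L : ℕ) (φ ψ : (Fin ν → ℤ) → F) (x : ℤ) :
    EE q ν L (fun j => φ j - ψ j) x = EE q ν L φ x - EE q ν L ψ x := by
  unfold EE
  rw [← finsum_sub_distrib (by exact EE_supp q ν L φ x) (by exact EE_supp q ν L ψ x)]
  apply finsum_congr
  intro j
  split_ifs
  · ring
  · ring

lemma EE_add {F : Type*} [Field F] (q : F) (ν L : ℕ) (φ ψ : (Fin ν → ℤ) → F) (x : ℤ) :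
    EE q ν L (fun j => φ j + ψ j) x = EE q ν L φ x + EE q ν L ψ x := by
  unfold EE
  rw [← finsum_add_distrib (by exact EE_supp q ν L φ x) (by exact EE_supp q ν L ψ x)]
  apply finsum_congr
  intro j
  split_ifs
  · ring
  · ring

lemma EE_mul {F : Type*} [Field F] (q : F) (ν L : ℕ) (φ : (Fin ν → ℤ) → F) (c : F) (x : ℤ) :
    EE q ν L (fun j => c * φ j) x = c * EE q ν L φ x := by
  unfold EE
  rw [mul_finsum]
  apply finsum_congr
  intro j
  split_ifs
  · ring
  · ring

lemma EE_congr {F : Type*} [Field F] (q : F) (ν L : ℕ) (φ ψ : (Fin ν → ℤ) → F) (x : ℤ)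
    (h : ∀ j : Fin ν → ℤ, ∑ l, j l = x → φ j = ψ j) : EE q ν L φ x = EE q ν L ψ x := by
  unfold EE
  apply finsum_congr
  intro j
  split_ifs with h1
  · rw [h j h1]
  · rfl

lemma site {F : Type*} [Field F] {q : F} (hq : q ≠ 0) (hq1 : ∀ n : ℕ, 0 < n → q ^ n ≠ 1)
    (ν L : ℕ) (j : Fin ν → ℤ) (k : Fin ν) :
    ww q L (j + Pi.single k 1) * (q ^ (JJ L j k) - q ^ (JJ L j ((k : ℕ) + 1) + 1))
      = q ^ (L : ℤ) * (q ^ (-JJ L j ((k : ℕ) + 2)) - q ^ (-JJ L j ((k : ℕ) + 1))) * ww q L j := by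
  have hk := k.2
  unfold ww
  have m1 : (k : ℕ) ∈ Finset.range (ν + 1) := Finset.mem_range.mpr (by omega)
  have m2 : (k : ℕ) + 1 ∈ (Finset.range (ν + 1)).erase k :=
    Finset.mem_erase.mpr ⟨by omega, Finset.mem_range.mpr (by omega)⟩
  rw [← Finset.mul_prod_erase _ _ m1, ← Finset.mul_prod_erase _ _ m2,
    ← Finset.mul_prod_erase _ (fac q (L : ℤ) j) m1, ← Finset.mul_prod_erase _ (fac q (L : ℤ) j) m2]
  have hR : ∏ i ∈ ((Finset.range (ν + 1)).erase k).erase ((k : ℕ) + 1),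
      fac q (L : ℤ) (j + Pi.single k 1) i
      = ∏ i ∈ ((Finset.range (ν + 1)).erase k).erase ((k : ℕ) + 1), fac q (L : ℤ) j i := by
    apply Finset.prod_congr rfl
    intro i hi
    simp only [Finset.mem_erase, ne_eq] at hi
    unfold fac
    rw [JJ_shift, JJ_shift, if_neg (by omega), if_neg (by omega), add_zero, add_zero]
  rw [hR]
  set R := ∏ i ∈ ((Finset.range (ν + 1)).erase k).erase ((k : ℕ) + 1), fac q (L : ℤ) j i
  unfold fac
  rw [JJ_shift, JJ_shift, JJ_shift, if_neg (by omega), if_pos rfl, if_neg (by omega), add_zero,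
    add_zero, show (k : ℕ) + 1 + 1 = k + 2 by ring]
  set A := JJ (L : ℤ) j k
  set B := JJ (L : ℤ) j (k + 1)
  set C := JJ (L : ℤ) j (k + 2)
  have r1 := iq_rec hq1 (B + 1 - A)
  have r2 := iq_rec hq1 (C - B)
  rw [show B + 1 - A - 1 = B - A by ring] at r1
  rw [show C - (B + 1) = C - B - 1 by ring, ← r2, ← r1]
  have e1 : q ^ A - q ^ (B + 1) = q ^ A * (1 - q ^ (B + 1 - A)) := by
    rw [mul_sub, mul_one, ← zpow_add₀ hq]
    congr 2
    ring
  have e2 : q ^ (-C) - q ^ (-B) = q ^ (-C) * (1 - q ^ (C - B)) := by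
    rw [mul_sub, mul_one, ← zpow_add₀ hq]
    congr 2
    ring
  have e3 : q ^ (A * (L - (B + 1))) * q ^ ((B + 1) * (L - C)) * q ^ A
      = q ^ (A * (L - B)) * q ^ (B * (L - C)) * (q ^ (L : ℤ) * q ^ (-C)) := by
    simp only [← zpow_add₀ hq]
    congr 1
    ring
  rw [e1, e2]
  linear_combination (qP q L * R * iq q (B + 1 - A) * (1 - q ^ (C - B)) * iq q (C - B)
    * (1 - q ^ (B + 1 - A))) * e3

lemma siteE {F : Type*} [Field F] {q : F} (hq : q ≠ 0) (hq1 : ∀ n : ℕ, 0 < n → q ^ n ≠ 1)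
    (ν L : ℕ) (k : Fin ν) (φ : (Fin ν → ℤ) → F) (x : ℤ) :
    EE q ν L (fun j => (q ^ (JJ L j k) - q ^ (JJ L j ((k : ℕ) + 1))) * φ j) x
      = q ^ (L : ℤ) * EE q ν L (fun j => (q ^ (-JJ L j ((k : ℕ) + 2)) - q ^ (-JJ L j ((k : ℕ) + 1)))
        * φ (j + Pi.single k 1)) (x - 1) := by
  unfold EE
  rw [mul_finsum, ← finsum_comp_equiv (Equiv.addRight (Pi.single k (1 : ℤ)))]
  apply finsum_congr
  intro j
  have he : Equiv.addRight (Pi.single k (1 : ℤ)) j = j + Pi.single k 1 := rfl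
  rw [he]
  have hs : ∑ l, (j + Pi.single k 1 : Fin ν → ℤ) l = ∑ l, j l + 1 := by
    simp [Finset.sum_add_distrib, Finset.sum_pi_single']
  by_cases h : ∑ l, j l = x - 1
  · rw [if_pos h, if_pos (hs.trans (by rw [h]; ring))]
    beta_reduce
    rw [JJ_shift, JJ_shift, if_neg (by omega), if_pos rfl, add_zero]
    linear_combination (φ (j + Pi.single k 1)) * site hq hq1 ν L j k
  · rw [if_neg h, if_neg (fun h' => h (by rw [hs] at h'; omega)), mul_zero]

lemma star {F : Type*} [Field F] {q : F} (hq : q ≠ 0) (hq1 : ∀ n : ℕ, 0 < n → q ^ n ≠ 1)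
    (ν L : ℕ) (u v : ℕ) (hv : v ≤ ν) (x : ℤ) (m : ℕ) (hm : u + m ≤ v) :
    EE q ν L (fun j => (q ^ (JJ L j u) - q ^ (JJ L j (u + m))) * q ^ (-SS L j u - SS L j v)) x
      = q ^ ((L : ℤ) - 1) * EE q ν L (fun j => (q ^ (-JJ L j (u + m + 1)) - q ^ (-JJ L j (u + 1)))
        * q ^ (-SS L j u - SS L j v)) (x - 1) := by
  induction m with
  | zero =>
    simp only [add_zero, sub_self, zero_mul]
    simp [EE]
  | succ m ih =>
    have ih' := ih (by omega)
    have hs := siteE hq hq1 ν L ⟨u + m, by omega⟩ (fun j => q ^ (-SS L j u - SS L j v)) x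
    simp only at hs
    have h1 : EE q ν L (fun j => (q ^ (JJ L j u) - q ^ (JJ L j (u + (m + 1))))
          * q ^ (-SS L j u - SS L j v)) x
        = EE q ν L (fun j => (q ^ (JJ L j u) - q ^ (JJ L j (u + m))) * q ^ (-SS L j u - SS L j v)) x
        + EE q ν L (fun j => (q ^ (JJ L j (u + m)) - q ^ (JJ L j (u + m + 1)))
          * q ^ (-SS L j u - SS L j v)) x := by
      rw [← EE_add]
      congr 1
      funext j
      rw [show u + (m + 1) = u + m + 1 by ring]
      ring
    rw [h1, ih', hs, ← EE_mul, ← EE_mul, ← EE_mul, ← EE_add]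
    congr 1
    funext j
    rw [SS_shift, SS_shift, if_neg (by simp), if_pos (by simp only; omega), add_zero,
      show u + (m + 1) + 1 = u + m + 2 by ring]
    have e : q ^ (L : ℤ) * q ^ (-SS L j u - (SS L j v + 1))
        = q ^ ((L : ℤ) - 1) * q ^ (-SS L j u - SS L j v) := by
      simp only [← zpow_add₀ hq]
      congr 1
      ring
    linear_combination (q ^ (-JJ L j (u + m + 2)) - q ^ (-JJ L j (u + m + 1))) * e

/-- two-index sums -/
def ZZ {F : Type*} [Field F] (q : F) (ν L u v : ℕ) (x : ℤ) : F :=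
  EE q ν L (fun j => q ^ (-SS L j u - SS L j v)) x

/-- the q-multinomial as a sum over integer sequences -/
def MM {F : Type*} [Field F] (q : F) (ν L p : ℕ) (x : ℤ) : F :=
  EE q ν L (fun j => q ^ (-SS L j p)) x

lemma ZZ_zero {F : Type*} [Field F] (q : F) (ν L v : ℕ) (x : ℤ) :
    ZZ q ν L 0 v x = MM q ν L v x := by
  unfold ZZ MM
  congr 1
  funext j
  rw [SS_zero]
  simp

lemma ZZ_nu {F : Type*} [Field F] {q : F} (hq : q ≠ 0) (ν L u : ℕ) (x : ℤ) :
    ZZ q ν L u ν x = q ^ (-x) * MM q ν L u x := by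
  unfold ZZ MM
  rw [← EE_mul]
  apply EE_congr
  intro j hj
  rw [SS_nu, hj, ← zpow_add₀ hq]
  congr 1
  ring

lemma ZZ_nu1 {F : Type*} [Field F] {q : F} (hq : q ≠ 0) (ν L u : ℕ) (x : ℤ) :
    ZZ q ν L u (ν + 1) x = q ^ (-x - L) * MM q ν L u x := by
  unfold ZZ MM
  rw [← EE_mul]
  apply EE_congr
  intro j hj
  rw [SS_succ, SS_nu, hj, JJ_top, ← zpow_add₀ hq]
  congr 1
  ring

lemma MM_nu1 {F : Type*} [Field F] {q : F} (hq : q ≠ 0) (ν L : ℕ) (x : ℤ) :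
    MM q ν L (ν + 1) x = q ^ (-(L : ℤ)) * MM q ν L ν x := by
  unfold MM
  rw [← EE_mul]
  apply EE_congr
  intro j hj
  rw [SS_succ, JJ_top, ← zpow_add₀ hq]
  congr 1
  ring

lemma MM_zero_nu {F : Type*} [Field F] {q : F} (hq : q ≠ 0) (ν L : ℕ) (x : ℤ) :
    MM q ν L 0 x = q ^ x * MM q ν L ν x := by
  unfold MM
  rw [← EE_mul]
  apply EE_congr
  intro j hj
  rw [SS_zero, SS_nu, hj, ← zpow_add₀ hq]
  congr 1
  ring

lemma star_rhs {F : Type*} [Field F] {q : F} (hq : q ≠ 0) (ν L u v : ℕ) (x : ℤ) :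
    EE q ν L (fun j => (q ^ (-JJ L j (v + 1)) - q ^ (-JJ L j (u + 1)))
        * q ^ (-SS L j u - SS L j v)) x = ZZ q ν L u (v + 1) x - ZZ q ν L (u + 1) v x := by
  unfold ZZ
  rw [← EE_sub]
  congr 1
  funext j
  rw [sub_mul, SS_succ, SS_succ, ← zpow_add₀ hq, ← zpow_add₀ hq]
  congr 2
  · ring
  · ring

lemma star_step {F : Type*} [Field F] {q : F} (hq : q ≠ 0) (hq1 : ∀ n : ℕ, 0 < n → q ^ n ≠ 1)
    (ν L u v : ℕ) (huv : u ≤ v) (hv : v + 1 ≤ ν) (x : ℤ) :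
    ZZ q ν L u (v + 1) x - ZZ q ν L (u + 1) v x
      = q ^ ((L : ℤ) - 1) * (ZZ q ν L (u + 1) (v + 2) (x - 1) - ZZ q ν L (u + 2) (v + 1) (x - 1)) := by
  have h := star hq hq1 ν L (u + 1) (v + 1) hv x (v - u) (by omega)
  rw [show u + 1 + (v - u) = v + 1 by omega, star_rhs hq] at h
  rw [show v + 2 = v + 1 + 1 by ring, show u + 2 = u + 1 + 1 by ring, ← h]
  unfold ZZ
  rw [← EE_sub]
  congr 1
  funext j
  rw [sub_mul, SS_succ, SS_succ, ← zpow_add₀ hq, ← zpow_add₀ hq]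
  congr 2
  · ring
  · ring

lemma star_init {F : Type*} [Field F] {q : F} (hq : q ≠ 0) (hq1 : ∀ n : ℕ, 0 < n → q ^ n ≠ 1)
    (ν L v : ℕ) (hv : v + 1 ≤ ν) (x : ℤ) :
    MM q ν L (v + 1) x - MM q ν L v x
      = q ^ ((L : ℤ) - 1) * (ZZ q ν L 0 (v + 2) (x - 1) - ZZ q ν L 1 (v + 1) (x - 1)) := by
  have h := star hq hq1 ν L 0 (v + 1) hv x (v + 1) (by omega)
  rw [zero_add, star_rhs hq] at h
  rw [show v + 2 = v + 1 + 1 by ring, ← h]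
  unfold MM
  rw [← EE_sub]
  congr 1
  funext j
  rw [sub_mul, SS_succ, SS_zero, JJ_zero, ← zpow_add₀ hq, ← zpow_add₀ hq]
  congr 2
  · ring
  · ring

lemma star_iter {F : Type*} [Field F] {q : F} (hq : q ≠ 0) (hq1 : ∀ n : ℕ, 0 < n → q ^ n ≠ 1)
    (ν L v : ℕ) (p : ℕ) (hv : v + p ≤ ν) (x : ℤ) :
    ZZ q ν L 0 (v + 1) x - ZZ q ν L 1 v x
      = q ^ ((p : ℤ) * ((L : ℤ) - 1)) * (ZZ q ν L p (v + p + 1) (x - p) - ZZ q ν L (p + 1) (v + p) (x - p)) := by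
  induction p with
  | zero => simp
  | succ p ih =>
    rw [ih (by omega), star_step hq hq1 ν L p (v + p) (by omega) (by omega), ← mul_assoc,
      ← zpow_add₀ hq]
    congr 1
    · congr 1
      push_cast
      ring
    · push_cast
      rw [show v + (p + 1) + 1 = v + p + 2 by ring, show v + (p + 1) = v + p + 1 by ring,
        show p + 1 + 1 = p + 2 by ring, show x - ((p : ℤ) + 1) = x - p - 1 by ring]

lemma taut {F : Type*} [Field F] {q : F} (hq : q ≠ 0) (hq1 : ∀ n : ℕ, 0 < n → q ^ n ≠ 1)
    (ν L p : ℕ) (hp : p + 1 ≤ ν) (x : ℤ) :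
    q ^ ((p : ℤ) * L) * MM q ν L p (x - p - 1) - q ^ (((p : ℤ) + 1) * L) * MM q ν L (p + 1) (x - p - 1)
      = q ^ x * (MM q ν L (ν - p) x - MM q ν L (ν - p - 1) x) := by
  have h1 := star_init hq hq1 ν L (ν - p - 1) (by omega) x
  have h2 := star_iter hq hq1 ν L (ν - p) p (by omega) (x - 1)
  rw [show ν - p - 1 + 1 = ν - p by omega, show ν - p - 1 + 2 = ν - p + 1 by omega, h2,
    show ν - p + p = ν by omega, ZZ_nu1 hq, ZZ_nu hq, show x - 1 - (p : ℤ) = x - p - 1 by ring] at h1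
  rw [h1]
  have e1 : q ^ ((p : ℤ) * L) = q ^ x * (q ^ ((L : ℤ) - 1) * (q ^ ((p : ℤ) * ((L : ℤ) - 1)) *
      q ^ (-(x - p - 1) - L))) := by
    simp only [← zpow_add₀ hq]
    congr 1
    ring
  have e2 : q ^ (((p : ℤ) + 1) * L) = q ^ x * (q ^ ((L : ℤ) - 1) * (q ^ ((p : ℤ) * ((L : ℤ) - 1)) *
      q ^ (-(x - p - 1)))) := by
    simp only [← zpow_add₀ hq]
    congr 1
    ring
  rw [e1, e2]
  ring

/-- complement -/
def compl {ν : ℕ} (L : ℤ) : (Fin ν → ℤ) ≃ (Fin ν → ℤ) where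
  toFun j := fun l => L - j (Fin.rev l)
  invFun j := fun l => L - j (Fin.rev l)
  left_inv j := by funext l; simp
  right_inv j := by funext l; simp

lemma JJ_compl {ν : ℕ} (L : ℤ) (j : Fin ν → ℤ) (i : ℕ) (hi : i ≤ ν + 1) :
    JJ L (compl L j) i = L - JJ L j (ν + 1 - i) := by
  by_cases h0 : i = 0
  · subst h0
    rw [JJ_zero, Nat.sub_zero, JJ_top]
    ring
  by_cases h1 : i = ν + 1
  · subst h1
    rw [JJ_top, Nat.sub_self, JJ_zero]
    ring
  obtain ⟨k, rfl⟩ : ∃ k : Fin ν, i = (k : ℕ) + 1 := ⟨⟨i - 1, by omega⟩, by simp only; omega⟩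
  have hk := k.2
  rw [JJ_fin, show ν + 1 - ((k : ℕ) + 1) = ((Fin.rev k : Fin ν) : ℕ) + 1 by
    rw [Fin.val_rev]; omega, JJ_fin]
  rfl

lemma ww_compl {F : Type*} [Field F] (q : F) (ν L : ℕ) (j : Fin ν → ℤ) :
    ww q L (compl L j) = ww q L j := by
  unfold ww
  congr 1
  rw [← Finset.prod_range_reflect (fac q (L : ℤ) j)]
  apply Finset.prod_congr rfl
  intro i hi
  have hi' := Finset.mem_range.mp hi
  unfold fac
  rw [JJ_compl _ _ _ (by omega), JJ_compl _ _ _ (by omega),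
    show ν + 1 - 1 - i + 1 = ν + 1 - i by omega, show ν + 1 - (i + 1) = ν + 1 - 1 - i by omega]
  congr 2
  · ring
  · ring

lemma SS_compl {ν : ℕ} (L : ℤ) (j : Fin ν → ℤ) (p : ℕ) (hp : p ≤ ν) :
    SS L (compl L j) p = p * L - ∑ l, j l + SS L j (ν - p) := by
  induction p with
  | zero => rw [SS_zero, Nat.sub_zero, SS_nu]; push_cast; ring
  | succ p ih =>
    rw [SS_succ, ih (by omega), JJ_compl _ _ _ (by omega), show ν + 1 - (p + 1) = ν - p by omega,
      show ν - p = (ν - (p + 1)) + 1 by omega, SS_succ]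
    push_cast
    ring

lemma MM_sym {F : Type*} [Field F] {q : F} (hq : q ≠ 0) (ν L p : ℕ) (hp : p ≤ ν) (x : ℤ) :
    MM q ν L p (ν * L - x) = q ^ (x - p * L) * MM q ν L (ν - p) x := by
  unfold MM
  rw [← EE_mul]
  unfold EE
  rw [← finsum_comp_equiv (compl (L : ℤ))]
  apply finsum_congr
  intro j
  rw [ww_compl]
  have hs : ∑ l, compl (L : ℤ) j l = ν * L - ∑ l, j l := by
    rw [← SS_nu (L : ℤ), SS_compl _ _ _ le_rfl, Nat.sub_self, SS_zero]
    ring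
  by_cases h : ∑ l, j l = x
  · rw [if_pos h, if_pos (by rw [hs, h])]
    beta_reduce
    rw [SS_compl _ _ _ hp, h, ← zpow_add₀ hq]
    congr 2
    ring
  · rw [if_neg h, if_neg (by rw [hs]; omega)]

lemma JJ_indep {ν : ℕ} (L L' : ℤ) (j : Fin ν → ℤ) (i : ℕ) (hi : i ≤ ν) : JJ L j i = JJ L' j i := by
  unfold JJ
  by_cases h0 : i = 0
  · simp [h0]
  · rw [if_neg h0, if_neg h0, dif_pos (by omega), dif_pos (by omega)]

lemma SS_indep {ν : ℕ} (L L' : ℤ) (j : Fin ν → ℤ) (p : ℕ) (hp : p ≤ ν) : SS L j p = SS L' j p := by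
  unfold SS
  apply Finset.sum_congr rfl
  intro i hi
  exact JJ_indep _ _ _ _ (by have := Finset.mem_range.mp hi; omega)

lemma ww_abs {F : Type*} [Field F] {q : F} (hq : q ≠ 0) (hq1 : ∀ n : ℕ, 0 < n → q ^ n ≠ 1)
    (ν L : ℕ) (j : Fin ν → ℤ) :
    ww q (L + 1) j * (q ^ (JJ ((L + 1 : ℕ) : ℤ) j ν) - q ^ ((L + 1 : ℕ) : ℤ))
      = (1 - q ^ ((L + 1 : ℕ) : ℤ)) * q ^ (∑ l, j l) * ww q L j := by
  unfold ww
  rw [Finset.prod_range_succ, Finset.prod_range_succ]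
  have hR : ∏ i ∈ Finset.range ν, fac q ((L + 1 : ℕ) : ℤ) j i
      = (∏ i ∈ Finset.range ν, q ^ (JJ (L : ℤ) j i)) * ∏ i ∈ Finset.range ν, fac q (L : ℤ) j i := by
    rw [← Finset.prod_mul_distrib]
    apply Finset.prod_congr rfl
    intro i hi
    have hi' := Finset.mem_range.mp hi
    unfold fac
    rw [JJ_indep ((L + 1 : ℕ) : ℤ) L j i (by omega), JJ_indep ((L + 1 : ℕ) : ℤ) L j (i + 1) (by omega),
      ← mul_assoc, ← zpow_add₀ hq]
    congr 2
    push_cast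
    ring
  have hS : (∏ i ∈ Finset.range ν, q ^ (JJ (L : ℤ) j i)) * q ^ (JJ (L : ℤ) j ν) = q ^ (∑ l, j l) := by
    rw [← Finset.prod_range_succ (fun i => q ^ (JJ (L : ℤ) j i)), ← SS_nu (L : ℤ), SS]
    generalize ν + 1 = m
    induction m with
    | zero => simp
    | succ m ih => rw [Finset.prod_range_succ, Finset.sum_range_succ, ih, zpow_add₀ hq]
  rw [hR, ← hS, JJ_indep ((L + 1 : ℕ) : ℤ) L j ν le_rfl]
  unfold fac
  rw [JJ_top, JJ_top, JJ_indep ((L + 1 : ℕ) : ℤ) L j ν le_rfl, qP_succ]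
  set A := JJ (L : ℤ) j ν
  have r := iq_rec hq1 ((L + 1 : ℕ) - A)
  rw [show ((L + 1 : ℕ) : ℤ) - A - 1 = L - A by push_cast; ring] at r
  have e1 : q ^ A - q ^ ((L + 1 : ℕ) : ℤ) = q ^ A * (1 - q ^ (((L + 1 : ℕ) : ℤ) - A)) := by
    rw [mul_sub, mul_one, ← zpow_add₀ hq]
    congr 2
    ring
  rw [e1, ← r, zpow_natCast]
  simp only [sub_self, mul_zero, zpow_zero, one_mul]
  ring

lemma MM_abs {F : Type*} [Field F] {q : F} (hq : q ≠ 0) (hq1 : ∀ n : ℕ, 0 < n → q ^ n ≠ 1)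
    (ν L u : ℕ) (hu : u ≤ ν) (x : ℤ) :
    EE q ν (L + 1) (fun j => (q ^ (JJ ((L + 1 : ℕ) : ℤ) j ν) - q ^ ((L + 1 : ℕ) : ℤ))
        * q ^ (-SS ((L + 1 : ℕ) : ℤ) j u)) x
      = (1 - q ^ ((L + 1 : ℕ) : ℤ)) * (q ^ x * MM q ν L u x) := by
  unfold MM
  rw [← EE_mul, ← EE_mul]
  unfold EE
  apply finsum_congr
  intro j
  by_cases h : ∑ l, j l = x
  · rw [if_pos h, if_pos h]
    have := ww_abs hq hq1 ν L j
    rw [h] at this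
    beta_reduce
    rw [SS_indep ((L + 1 : ℕ) : ℤ) L j u hu]
    linear_combination q ^ (-SS (L : ℤ) j u) * this
  · rw [if_neg h, if_neg h]

lemma star_nu {F : Type*} [Field F] {q : F} (hq : q ≠ 0) (hq1 : ∀ n : ℕ, 0 < n → q ^ n ≠ 1)
    (ν L u : ℕ) (hu : u ≤ ν) (x : ℤ) :
    EE q ν L (fun j => (q ^ (JJ L j u) - q ^ (JJ L j ν)) * q ^ (-SS L j u)) x
      = MM q ν L u (x - 1) - q ^ (L : ℤ) * MM q ν L (u + 1) (x - 1) := by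
  have h := star hq hq1 ν L u ν le_rfl x (ν - u) (by omega)
  rw [show u + (ν - u) = ν by omega, star_rhs hq, ZZ_nu1 hq, ZZ_nu hq] at h
  have h2 : EE q ν L (fun j => (q ^ (JJ L j u) - q ^ (JJ L j ν)) * q ^ (-SS L j u)) x
      = q ^ x * EE q ν L (fun j => (q ^ (JJ L j u) - q ^ (JJ L j ν)) * q ^ (-SS L j u - SS L j ν)) x := by
    rw [← EE_mul]
    apply EE_congr
    intro j hj
    rw [SS_nu, hj, show -SS (L : ℤ) j u = x + (-SS (L : ℤ) j u - x) by ring, zpow_add₀ hq x]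
    ring
  rw [h2, h]
  have e1 : q ^ x * (q ^ ((L : ℤ) - 1) * q ^ (-(x - 1) - L)) = 1 := by
    simp only [← zpow_add₀ hq]
    rw [← zpow_zero q]
    congr 1
    ring
  have e2 : q ^ x * (q ^ ((L : ℤ) - 1) * q ^ (-(x - 1))) = q ^ (L : ℤ) := by
    simp only [← zpow_add₀ hq]
    congr 1
    ring
  linear_combination MM q ν L u (x - 1) * e1 - MM q ν L (u + 1) (x - 1) * e2

/-- partial sums `U_n` -/
def UU {F : Type*} [Field F] (q : F) (ν L n : ℕ) (x : ℤ) : F :=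
  ∑ m ∈ Finset.range n, q ^ ((m : ℤ) * L) * MM q ν L m (x - m)

lemma UU_succ {F : Type*} [Field F] (q : F) (ν L n : ℕ) (x : ℤ) :
    UU q ν L (n + 1) x = UU q ν L n x + q ^ ((n : ℤ) * L) * MM q ν L n (x - n) := by
  unfold UU
  rw [Finset.sum_range_succ]

lemma UU_zero {F : Type*} [Field F] (q : F) (ν L : ℕ) (x : ℤ) : UU q ν L 0 x = 0 := by
  simp [UU]

lemma UU_one {F : Type*} [Field F] (q : F) (ν L : ℕ) (x : ℤ) :
    UU q ν L 1 x = MM q ν L 0 x := by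
  simp [UU]

lemma UV {F : Type*} [Field F] {q : F} (hq : q ≠ 0) (hq1 : ∀ n : ℕ, 0 < n → q ^ n ≠ 1)
    (ν L p : ℕ) (hp : p ≤ ν) (x : ℤ) :
    UU q ν L (p + 1) x = q ^ x * MM q ν L (ν - p) x + UU q ν L p (x - 1) := by
  induction p with
  | zero => rw [UU_zero, zero_add, UU_one, Nat.sub_zero, add_zero, MM_zero_nu hq]
  | succ p ih =>
    have ih' := ih (by omega)
    rw [UU_succ, ih', UU_succ q ν L p (x - 1)]
    have h := taut hq hq1 ν L p hp x
    rw [show ν - p - 1 = ν - (p + 1) by omega] at h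
    push_cast
    rw [show x - ((p : ℤ) + 1) = x - p - 1 by ring, show x - 1 - (p : ℤ) = x - p - 1 by ring]
    linear_combination -h

lemma UU_sym {F : Type*} [Field F] {q : F} (hq : q ≠ 0) (hq1 : ∀ n : ℕ, 0 < n → q ^ n ≠ 1)
    (ν L n : ℕ) (hn : n ≤ ν + 1) (x : ℤ) :
    UU q ν L n x = UU q ν L n (ν * L - x + n - 1) := by
  induction n generalizing x with
  | zero => rw [UU_zero, UU_zero]
  | succ p ih =>
    rw [UV hq hq1 ν L p (by omega), UU_succ, ih (by omega) (x - 1)]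
    push_cast
    rw [show (ν : ℤ) * L - x + (p + 1) - 1 - p = ν * L - x by ring, MM_sym hq _ _ _ (by omega),
      ← mul_assoc, ← zpow_add₀ hq, show (p : ℤ) * L + (x - p * L) = x by ring,
      show (ν : ℤ) * L - (x - 1) + p - 1 = ν * L - x + (p + 1) - 1 by ring]
    ring

lemma QQ_eq {F : Type*} [Field F] {q : F} (hq : q ≠ 0) (hq1 : ∀ n : ℕ, 0 < n → q ^ n ≠ 1)
    (ν L p : ℕ) (hp : p ≤ ν) (x : ℤ) :
    MM q ν (L + 1) (ν - p) x - q ^ ((L + 1 : ℕ) : ℤ) * MM q ν (L + 1) (ν - p + 1) x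
      = (1 - q ^ ((L + 1 : ℕ) : ℤ)) * UU q ν L p x := by
  induction p generalizing x with
  | zero =>
    rw [UU_zero, Nat.sub_zero, MM_nu1 hq, ← mul_assoc, ← zpow_add₀ hq]
    simp
  | succ p ih =>
    have ih' := ih (by omega) (x - 1)
    rw [UV hq hq1 ν L p (by omega), mul_add, ← ih', ← MM_abs hq hq1 ν L (ν - p) (by omega),
      ← star_nu hq hq1 ν (L + 1) (ν - p) (by omega), ← EE_add]
    unfold MM
    rw [← EE_mul, ← EE_sub]
    congr 1
    funext j
    rw [show ν - p = ν - (p + 1) + 1 by omega, SS_succ]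
    rw [show -SS ((L + 1 : ℕ) : ℤ) j (ν - (p + 1)) = JJ ((L + 1 : ℕ) : ℤ) j (ν - (p + 1) + 1)
      + -(SS ((L + 1 : ℕ) : ℤ) j (ν - (p + 1)) + JJ ((L + 1 : ℕ) : ℤ) j (ν - (p + 1) + 1)) by ring,
      zpow_add₀ hq (JJ ((L + 1 : ℕ) : ℤ) j (ν - (p + 1) + 1))]
    ring

lemma MM_zero_eq {F : Type*} [Field F] {q : F} (hq : q ≠ 0) (hq1 : ∀ n : ℕ, 0 < n → q ^ n ≠ 1)
    (ν L : ℕ) (x : ℤ) : MM q ν (L + 1) 0 x = UU q ν L (ν + 1) x := by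
  have h0 : (1 - q ^ ((L + 1 : ℕ) : ℤ)) ≠ 0 := by
    rw [zpow_natCast]
    exact fun h => hq1 (L + 1) (by omega) (sub_eq_zero.mp h).symm
  apply mul_left_cancel₀ h0
  have h := QQ_eq hq hq1 ν L ν le_rfl (x - 1)
  rw [Nat.sub_self] at h
  rw [UV hq hq1 ν L ν le_rfl, mul_add, ← h, Nat.sub_self, ← MM_abs hq hq1 ν L 0 (by omega),
      ← star_nu hq hq1 ν (L + 1) 0 (by omega), ← EE_add]
  unfold MM
  rw [← EE_mul]
  congr 1
  funext j
  rw [JJ_zero]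
  simp only [zpow_zero]
  ring

lemma MM_R {F : Type*} [Field F] {q : F} (hq : q ≠ 0) (hq1 : ∀ n : ℕ, 0 < n → q ^ n ≠ 1)
    (ν L p b : ℕ) (hp : p + b = ν) (a : ℤ) :
    MM q ν (L + 1) p a = UU q ν L (b + 1) a
      + q ^ (((L : ℤ) + 1) * b - a) * UU q ν L p (ν * ((L : ℤ) + 1) - a) := by
  induction p generalizing b with
  | zero =>
    rw [UU_zero, show b = ν by omega, MM_zero_eq hq hq1]
    ring
  | succ p ih =>
    have ih' := ih (b + 1) (by omega)
    have h := QQ_eq hq hq1 ν L (p + 1) (by omega) (ν * ((L : ℤ) + 1) - a)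
    have s1 := MM_sym hq ν (L + 1) p (by omega) (ν * ((L : ℤ) + 1) - a)
    have s2 := MM_sym hq ν (L + 1) (p + 1) (by omega) (ν * ((L : ℤ) + 1) - a)
    have s3 := MM_sym hq ν L (b + 1) (by omega) (ν * L + (b + 1) - a)
    have hν : (ν : ℤ) = p + 1 + b := by omega
    rw [show ν - (p + 1) + 1 = b + 1 by omega, show ν - (p + 1) = b by omega] at h
    rw [show ν - p = b + 1 by omega] at s1
    rw [show ν - (p + 1) = b by omega] at s2
    rw [show ν - (b + 1) = p by omega,
      show (ν : ℤ) * L - (ν * L + (b + 1) - a) = a - (b + 1) by ring] at s3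
    push_cast at h s1 s2 s3 ih' ⊢
    rw [sub_sub_cancel] at s1 s2
    rw [UU_succ q ν L (b + 1)] at ih'
    rw [UU_succ q ν L p] at h ⊢
    push_cast at ih'
    rw [s3, show (ν : ℤ) * L + (b + 1) - a = ν * (L + 1) - a - p by rw [hν]; ring] at ih'
    rw [s1] at ih'
    rw [s2]
    set y := (ν : ℤ) * (L + 1) - a with hy
    have e0 : q ^ ((L : ℤ) + 1) ≠ 0 := zpow_ne_zero _ hq
    have e1 : q ^ (y - (p : ℤ) * (L + 1)) = q ^ (y - ((p : ℤ) + 1) * (L + 1)) * q ^ ((L : ℤ) + 1) := by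
      rw [← zpow_add₀ hq]; congr 1; ring
    have e2 : q ^ (((L : ℤ) + 1) * (b + 1) - a) = q ^ (y - ((p : ℤ) + 1) * (L + 1)) * q ^ ((L : ℤ) + 1) := by
      rw [← zpow_add₀ hq]; congr 1; rw [hy, hν]; ring
    have e3 : q ^ (((L : ℤ) + 1) * b - a) = q ^ (y - ((p : ℤ) + 1) * (L + 1)) := by
      congr 1; rw [hy, hν]; ring
    have e4 : q ^ (((b : ℤ) + 1) * L) * q ^ (y - p - ((b : ℤ) + 1) * L)
        = q ^ (y - ((p : ℤ) + 1) * (L + 1)) * q ^ ((L : ℤ) + 1) * q ^ ((p : ℤ) * L) := by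
      simp only [← zpow_add₀ hq]; congr 1; ring
    rw [e1, e2] at ih'
    rw [e3]
    linear_combination ih' + q ^ (y - ((p : ℤ) + 1) * (L + 1)) * h + MM q ν L p (y - p) * e4

/-! ### The q-multinomials as weighted sums over integer sequences -/

lemma finsum_inj {α β F : Type*} [AddCommMonoid F] (φ : α → β) (hφ : Function.Injective φ)
    (f : β → F) (hf : ∀ y, f y ≠ 0 → ∃ x, φ x = y) : ∑ᶠ y, f y = ∑ᶠ x, f (φ x) := by
  rw [← finsum_mem_range hφ]
  apply finsum_congr
  intro y
  rw [finsum_eq_if]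
  by_cases h : y ∈ Set.range φ
  · rw [if_pos h]
  · rw [if_neg h]
    by_contra h2
    exact h (hf y h2)

lemma qB_iq {F : Type*} [Field F] {q : F} (hq1 : ∀ n : ℕ, 0 < n → q ^ n ≠ 1) (N k : ℤ) :
    qB q N k * iq q N = iq q k * iq q (N - k) := by
  unfold qB iq
  by_cases h : 0 ≤ k ∧ k ≤ N
  · rw [if_pos h, if_neg (by omega), if_neg (by omega), if_neg (by omega)]
    have h1 := qP_ne hq1 N.toNat
    have h2 := qP_ne hq1 k.toNat
    have h3 := qP_ne hq1 (N - k).toNat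
    field_simp
  · rw [if_neg h, zero_mul]
    by_cases hk : k < 0
    · rw [if_pos hk, zero_mul]
    · rw [if_pos (show N - k < 0 by omega), mul_zero]

lemma chain_prod {F : Type*} [Field F] {q : F} (hq1 : ∀ n : ℕ, 0 < n → q ^ n ≠ 1)
    (J : ℕ → ℤ) (h0 : J 0 = 0) (t : ℕ) :
    ∏ i ∈ Finset.range (t + 1), iq q (J (i + 1) - J i)
      = iq q (J (t + 1)) * ∏ i ∈ Finset.range t, qB q (J (i + 2)) (J (i + 1)) := by
  induction t with
  | zero => simp [h0]
  | succ t ih =>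
    rw [Finset.prod_range_succ, ih, Finset.prod_range_succ]
    have h := qB_iq hq1 (J (t + 2)) (J (t + 1))
    linear_combination (-∏ i ∈ Finset.range t, qB q (J (i + 2)) (J (i + 1))) * h

lemma prod_Icc_two {F : Type*} [CommMonoid F] (f : ℕ → F) (n : ℕ) :
    ∏ l ∈ Finset.Icc 2 (n + 1), f l = ∏ i ∈ Finset.range n, f (i + 2) := by
  induction n with
  | zero => simp
  | succ n ih => rw [Finset.prod_Icc_succ_top (by omega), ih, Finset.prod_range_succ]

lemma sum_Icc_two {F : Type*} [AddCommMonoid F] (f : ℕ → F) (n : ℕ) :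
    ∑ l ∈ Finset.Icc 2 (n + 1), f l = ∑ i ∈ Finset.range n, f (i + 2) := by
  induction n with
  | zero => simp
  | succ n ih => rw [Finset.sum_Icc_succ_top (by omega), ih, Finset.sum_range_succ]

lemma sum_Icc_one {F : Type*} [AddCommMonoid F] (f : ℕ → F) (n : ℕ) :
    ∑ l ∈ Finset.Icc 1 n, f l = ∑ i ∈ Finset.range n, f (i + 1) := by
  induction n with
  | zero => simp
  | succ n ih => rw [Finset.sum_Icc_succ_top (by omega), ih, Finset.sum_range_succ]

lemma ww_nonneg {F : Type*} [Field F] (q : F) (ν L : ℕ) (j : Fin ν → ℤ) (hj : ww q L j ≠ 0)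
    (k : Fin ν) : 0 ≤ j k ∧ j k ≤ L := by
  have h1 := right_ne_zero_of_mul hj
  rw [Finset.prod_ne_zero_iff] at h1
  have step : ∀ i, i ≤ ν → JJ (L : ℤ) j i ≤ JJ (L : ℤ) j (i + 1) := by
    intro i hi
    have h2 := right_ne_zero_of_mul (h1 i (Finset.mem_range.mpr (by omega)))
    unfold iq at h2
    by_contra h3
    exact h2 (if_pos (by omega))
  have up : ∀ i, i ≤ ν + 1 → 0 ≤ JJ (L : ℤ) j i := by
    intro i
    induction i with
    | zero => intro _; rw [JJ_zero]
    | succ i ih => intro hi; exact (ih (by omega)).trans (step i (by omega))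
  have down : ∀ m, ∀ i, i + m = ν + 1 → JJ (L : ℤ) j i ≤ L := by
    intro m
    induction m with
    | zero => intro i hi; rw [show i = ν + 1 by omega, JJ_top]
    | succ m ih => intro i hi; exact (step i (by omega)).trans (ih (i + 1) (by omega))
  have hk := k.2
  rw [← JJ_fin (L : ℤ) j k]
  exact ⟨up _ (by omega), down (ν - k) _ (by omega)⟩

lemma prod_zpow_sum {F : Type*} [Field F] {q : F} (hq : q ≠ 0) (f : ℕ → ℤ) (n : ℕ) :
    ∏ i ∈ Finset.range n, q ^ f i = q ^ ∑ i ∈ Finset.range n, f i := by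
  induction n with
  | zero => simp
  | succ n ih => rw [Finset.prod_range_succ, Finset.sum_range_succ, ih, zpow_add₀ hq]

lemma ww_eq {F : Type*} [Field F] {q : F} (hq : q ≠ 0) (hq1 : ∀ n : ℕ, 0 < n → q ^ n ≠ 1)
    (n L : ℕ) (j : Fin (n + 1) → ℤ) :
    ww q L j = q ^ (∑ i ∈ Finset.range n, JJ L j (i + 1) * (L - JJ L j (i + 2)))
      * (qB q L (JJ L j (n + 1)) * ∏ i ∈ Finset.range n, qB q (JJ L j (i + 2)) (JJ L j (i + 1))) := by
  unfold ww fac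
  rw [Finset.prod_mul_distrib, chain_prod hq1 (JJ (L : ℤ) j) (JJ_zero _ _), prod_zpow_sum hq,
    Finset.sum_range_succ, Finset.sum_range_succ', Finset.prod_range_succ, JJ_zero]
  have e : JJ (L : ℤ) j (n + 2) = L := JJ_top _ _
  rw [show n + 1 + 1 = n + 2 from rfl, e, sub_self, mul_zero, zero_mul, add_zero, add_zero]
  have h1 : qP q L * iq q (L : ℤ) = 1 := by
    unfold iq
    rw [if_neg (by omega), Int.toNat_natCast]
    exact mul_inv_cancel₀ (qP_ne hq1 L)
  linear_combination q ^ (∑ i ∈ Finset.range n, JJ L j (i + 1) * (L - JJ L j (i + 2)))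
      * (qB q L (JJ L j (n + 1)) * ∏ i ∈ Finset.range n, qB q (JJ L j (i + 2)) (JJ L j (i + 1))) * h1

lemma qMulti_eq {F : Type*} [Field F] {q : F} (hq : q ≠ 0) (hq1 : ∀ n : ℕ, 0 < n → q ^ n ≠ 1)
    (ν L p : ℕ) (hν : 1 ≤ ν) (hp : p ≤ ν) (x : ℤ) : qMulti ν L x p q = MM q ν L p x := by
  obtain ⟨n, rfl⟩ : ∃ n, ν = n + 1 := ⟨ν - 1, by omega⟩
  unfold qMulti MM EE
  rw [finsum_inj (fun (j : Fin (n + 1) → ℕ) (l : Fin (n + 1)) => (j l : ℤ))]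
  · apply finsum_congr
    intro j
    by_cases h : (∑ l, (j l : ℤ)) = x
    · rw [if_pos h, if_pos h]
      beta_reduce
      have hJ : ∀ i, i < n + 1 → jjf j (i + 1) = JJ (L : ℤ) (fun l => (j l : ℤ)) (i + 1) := by
        intro i hi
        unfold jjf JJ
        have hi2 : i ≤ n := by omega
        simp [hi2]
      rw [ww_eq hq hq1, sum_Icc_two, sum_Icc_one, prod_Icc_two, hJ n (by omega)]
      have e1 : ∑ i ∈ Finset.range n, jjf j (i + 2 - 1) * ((L : ℤ) - jjf j (i + 2))
          = ∑ i ∈ Finset.range n, JJ (L : ℤ) (fun l => (j l : ℤ)) (i + 1)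
            * (L - JJ (L : ℤ) (fun l => (j l : ℤ)) (i + 2)) := by
        apply Finset.sum_congr rfl
        intro i hi
        have hi := Finset.mem_range.mp hi
        rw [show i + 2 - 1 = i + 1 by omega, hJ i (by omega), hJ (i + 1) (by omega)]
      have e2 : ∏ i ∈ Finset.range n, qB q (jjf j (i + 2)) (jjf j (i + 2 - 1))
          = ∏ i ∈ Finset.range n, qB q (JJ (L : ℤ) (fun l => (j l : ℤ)) (i + 2))
            (JJ (L : ℤ) (fun l => (j l : ℤ)) (i + 1)) := by
        apply Finset.prod_congr rfl
        intro i hi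
        have hi := Finset.mem_range.mp hi
        rw [show i + 2 - 1 = i + 1 by omega, hJ i (by omega), hJ (i + 1) (by omega)]
      have e3 : ∑ i ∈ Finset.range p, jjf j (i + 1) = SS (L : ℤ) (fun l => (j l : ℤ)) p := by
        unfold SS
        rw [Finset.sum_range_succ', JJ_zero, add_zero]
        apply Finset.sum_congr rfl
        intro i hi
        have hi := Finset.mem_range.mp hi
        exact hJ i (by omega)
      rw [e1, e2, e3, sub_eq_add_neg, zpow_add₀ hq]
      ring
    · rw [if_neg h, if_neg h]
  · intro a b hab
    funext l
    have h := congrFun hab l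
    simp only at h
    exact_mod_cast h
  · intro j hj
    have hw : ww q L j ≠ 0 := by
      intro h0
      apply hj
      simp [h0]
    refine ⟨fun l => (j l).toNat, ?_⟩
    funext l
    have := (ww_nonneg q _ L j hw l).1
    simp only
    omega

lemma MM_supp {F : Type*} [Field F] (q : F) (ν L p : ℕ) (x : ℤ) (h : MM q ν L p x ≠ 0) :
    0 ≤ x ∧ x ≤ ν * L := by
  unfold MM EE at h
  obtain ⟨j, hj⟩ : ∃ j : Fin ν → ℤ,
      (if ∑ l, j l = x then ww q L j * q ^ (-SS (L : ℤ) j p) else 0) ≠ 0 := by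
    by_contra hc
    push Not at hc
    exact h (by rw [finsum_congr hc, finsum_zero])
  by_cases hx : ∑ l, j l = x
  · rw [if_pos hx] at hj
    have hw := ww_nonneg q ν L j (left_ne_zero_of_mul hj)
    rw [← hx]
    constructor
    · exact Finset.sum_nonneg (fun l _ => (hw l).1)
    · calc ∑ l, j l ≤ ∑ _l : Fin ν, (L : ℤ) := Finset.sum_le_sum (fun l _ => (hw l).2)
        _ = ν * L := by simp
  · exact absurd (if_neg hx) hj

lemma MM_L_zero {F : Type*} [Field F] {q : F} (ν p : ℕ) (hp : p ≤ ν) (x : ℤ) :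
    MM q ν 0 p x = if x = 0 then 1 else 0 := by
  by_cases hx : x = 0
  · subst hx
    rw [if_pos rfl]
    unfold MM EE
    have hJ : ∀ i, JJ (ν := ν) (0 : ℤ) 0 i = 0 := by
      intro i
      simp [JJ]
    rw [finsum_eq_single _ (0 : Fin ν → ℤ)]
    · simp [SS, hJ, ww, fac, iq, qP]
    · intro j hj
      by_contra hne
      apply hj
      have hw : ww q 0 j ≠ 0 := by
        intro h0
        apply hne
        simp [h0]
      funext l
      have := ww_nonneg q ν 0 j hw l
      simp only [Pi.zero_apply]
      omega
  · rw [if_neg hx]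
    by_contra h
    have := MM_supp q ν 0 p x h
    simp at this
    omega

/-! ### The alternating sums -/

/-- the alternating sum, indexed by the argument of the q-multinomial -/
def XX {F : Type*} [Field F] (q : F) (g : ℤ → F) (ν b L : ℕ) : F :=
  ∑ᶠ a : ℤ, g (2 * a - (ν * L + b + 1)) * MM q ν L (ν - b) a

lemma MM_fin {F : Type*} [Field F] (q : F) (ν L p : ℕ) (c : ℤ) :
    {a : ℤ | MM q ν L p (a - c) ≠ 0}.Finite := by
  refine (Set.finite_Icc c (ν * L + c)).subset ?_
  intro a ha
  have := MM_supp q ν L p _ ha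
  rw [Set.mem_Icc]
  constructor <;> linarith

lemma UU_fin {F : Type*} [Field F] (q : F) (ν L n : ℕ) :
    {a : ℤ | UU q ν L n a ≠ 0}.Finite := by
  induction n with
  | zero => simp [UU_zero]
  | succ n ih =>
    refine (ih.union (MM_fin q ν L n n)).subset ?_
    intro a ha
    by_contra h
    rw [Set.mem_union, not_or] at h
    obtain ⟨h1, h2⟩ := h
    have h1' : UU q ν L n a = 0 := by_contra h1
    have h2' : MM q ν L n (a - n) = 0 := by_contra h2
    apply ha
    rw [UU_succ, h1', h2']
    simp

lemma supp_mul {F : Type*} [Field F] (h f : ℤ → F) (hf : {a : ℤ | f a ≠ 0}.Finite) :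
    (Function.support (fun a => h a * f a)).Finite :=
  hf.subset (fun _ ha => right_ne_zero_of_mul ha)

lemma supp_mul_refl {F : Type*} [Field F] (h f : ℤ → F) (c : ℤ) (hf : {a : ℤ | f a ≠ 0}.Finite) :
    (Function.support (fun a => h a * f (c - a))).Finite := by
  refine (hf.preimage (f := fun a => c - a) ?_).subset (fun _ ha => right_ne_zero_of_mul ha)
  intro a _ b _ hab
  simp only at hab
  omega

lemma finsum_refl {F : Type*} [AddCommMonoid F] (f : ℤ → F) (c : ℤ) :
    ∑ᶠ a, f a = ∑ᶠ a, f (c - a) :=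
  (finsum_comp_equiv (Equiv.subLeft c) (f := f)).symm

lemma finsum_tr {F : Type*} [AddCommMonoid F] (f : ℤ → F) (c : ℤ) :
    ∑ᶠ a, f a = ∑ᶠ a, f (a + c) :=
  (finsum_comp_equiv (Equiv.addRight c) (f := f)).symm

lemma XX_V1 {F : Type*} [Field F] {q : F} (hq : q ≠ 0) (hq1 : ∀ n : ℕ, 0 < n → q ^ n ≠ 1)
    (h2 : (2 : F) ≠ 0) (g : ℤ → F) (hg : ∀ r, g (-r) = -(q ^ (-r) * g r))
    (ν b L : ℕ) (hb : b ≤ ν) :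
    XX q g ν b (L + 1)
      = ∑ᶠ a : ℤ, g (2 * a - (ν * ((L : ℤ) + 1) + b + 1)) * UU q ν L (b + 1) a := by
  have key : ∑ᶠ a : ℤ, g (2 * a - (ν * ((L : ℤ) + 1) + b + 1)) *
      (q ^ (((L : ℤ) + 1) * b - a) * UU q ν L (ν - b) (ν * ((L : ℤ) + 1) - a)) = 0 := by
    have e : ∑ᶠ a : ℤ, g (2 * a - (ν * ((L : ℤ) + 1) + b + 1)) *
      (q ^ (((L : ℤ) + 1) * b - a) * UU q ν L (ν - b) (ν * ((L : ℤ) + 1) - a))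
      = -∑ᶠ a : ℤ, g (2 * a - (ν * ((L : ℤ) + 1) + b + 1)) *
      (q ^ (((L : ℤ) + 1) * b - a) * UU q ν L (ν - b) (ν * ((L : ℤ) + 1) - a)) := by
      conv_lhs => rw [finsum_refl _ (ν * ((L : ℤ) + 1) + b + 1)]
      rw [← finsum_neg_distrib]
      apply finsum_congr
      intro a
      have e1 := hg (2 * a - (ν * ((L : ℤ) + 1) + b + 1))
      have e2 := UU_sym hq hq1 ν L (ν - b) (by omega) (ν * ((L : ℤ) + 1) - a)
      have e3 : (ν : ℤ) * L - (ν * ((L : ℤ) + 1) - a) + ((ν - b : ℕ) : ℤ) - 1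
          = ν * ((L : ℤ) + 1) - (ν * ((L : ℤ) + 1) + b + 1 - a) := by
        push_cast [hb]
        ring
      rw [e3] at e2
      rw [← e2, show 2 * ((ν : ℤ) * ((L : ℤ) + 1) + b + 1 - a) - (ν * ((L : ℤ) + 1) + b + 1)
        = -(2 * a - (ν * ((L : ℤ) + 1) + b + 1)) by ring, e1]
      have e4 : q ^ (-(2 * a - ((ν : ℤ) * ((L : ℤ) + 1) + b + 1))) *
          q ^ (((L : ℤ) + 1) * b - (ν * ((L : ℤ) + 1) + b + 1 - a)) = q ^ (((L : ℤ) + 1) * b - a) := by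
        rw [← zpow_add₀ hq]; congr 1; ring
      rw [← e4]
      ring
    have e' := e
    rw [eq_neg_iff_add_eq_zero, ← two_mul] at e'
    exact (mul_eq_zero.mp e').resolve_left h2
  unfold XX
  rw [← add_zero (∑ᶠ a : ℤ, g (2 * a - (ν * ((L : ℤ) + 1) + b + 1)) * UU q ν L (b + 1) a), ← key,
    ← finsum_add_distrib (by exact supp_mul _ _ (UU_fin q ν L (b + 1)))]
  · apply finsum_congr
    intro a
    rw [MM_R hq hq1 ν L (ν - b) b (by omega)]
    push_cast
    ring
  · have := supp_mul_refl (fun a : ℤ => g (2 * a - (ν * ((L : ℤ) + 1) + b + 1)) *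
      q ^ (((L : ℤ) + 1) * b - a)) _ (ν * ((L : ℤ) + 1)) (UU_fin q ν L (ν - b))
    simp only [mul_assoc] at this
    exact this

lemma XX_rec0 {F : Type*} [Field F] {q : F} (hq : q ≠ 0) (hq1 : ∀ n : ℕ, 0 < n → q ^ n ≠ 1)
    (h2 : (2 : F) ≠ 0) (g : ℤ → F) (hg : ∀ r, g (-r) = -(q ^ (-r) * g r)) (ν L : ℕ) :
    XX q g ν 0 (L + 1) = XX q g ν ν L := by
  rw [XX_V1 hq hq1 h2 g hg ν 0 L (by omega)]
  unfold XX
  apply finsum_congr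
  intro a
  rw [zero_add, UU_one, Nat.sub_self]
  congr 2

lemma XX_rec {F : Type*} [Field F] {q : F} (hq : q ≠ 0) (hq1 : ∀ n : ℕ, 0 < n → q ^ n ≠ 1)
    (h2 : (2 : F) ≠ 0) (g : ℤ → F) (hg : ∀ r, g (-r) = -(q ^ (-r) * g r)) (ν b L : ℕ)
    (hg2 : ∀ r, g (-(2 * (ν : ℤ) + 3) - r) = g r) (hb : b + 1 ≤ ν) :
    XX q g ν (b + 1) (L + 1) - XX q g ν b (L + 1)
      = q ^ (L * (b + 1)) * XX q g ν (ν - (b + 1)) L := by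
  rw [XX_V1 hq hq1 h2 g hg ν (b + 1) L (by omega), XX_V1 hq hq1 h2 g hg ν b L (by omega),
    finsum_refl (fun a : ℤ => g (2 * a - (ν * ((L : ℤ) + 1) + b + 1)) * UU q ν L (b + 1) a)
      (ν * L + b)]
  have e : ∀ a : ℤ, g (2 * ((ν : ℤ) * L + b - a) - (ν * ((L : ℤ) + 1) + b + 1)) *
      UU q ν L (b + 1) (ν * L + b - a) =
      g (2 * a - (ν * ((L : ℤ) + 1) + (b + 1 : ℕ) + 1)) * UU q ν L (b + 1) a := by
    intro a
    rw [UU_sym hq hq1 ν L (b + 1) (by omega) a, ← hg2 (2 * a - (ν * ((L : ℤ) + 1) + (b + 1 : ℕ) + 1))]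
    push_cast
    congr 2 <;> ring
  rw [finsum_congr e, ← finsum_sub_distrib (by exact supp_mul _ _ (UU_fin q ν L (b + 1 + 1)))
    (by exact supp_mul _ _ (UU_fin q ν L (b + 1)))]
  unfold XX
  rw [mul_finsum, finsum_tr _ ((b : ℤ) + 1)]
  apply finsum_congr
  intro a
  rw [UU_succ, show ν - (ν - (b + 1)) = b + 1 by omega]
  have e1 : (((ν - (b + 1) : ℕ)) : ℤ) = ν - (b + 1) := by omega
  have e2 : q ^ ((((b + 1 : ℕ)) : ℤ) * L) = q ^ (L * (b + 1)) := by
    rw [← zpow_natCast]; congr 1; push_cast; ring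
  rw [e1, e2, show a + ((b : ℤ) + 1) - ((b + 1 : ℕ) : ℤ) = a by push_cast; ring,
    show 2 * (a + ((b : ℤ) + 1)) - (ν * ((L : ℤ) + 1) + ((b + 1 : ℕ) : ℤ) + 1)
      = 2 * a - (ν * (L : ℤ) + (ν - (b + 1)) + 1) by push_cast; ring]
  ring

lemma XX_zero {F : Type*} [Field F] (q : F) (g : ℤ → F) (ν b : ℕ) :
    XX q g ν b 0 = g (-(b + 1)) := by
  unfold XX
  rw [finsum_eq_single _ 0]
  · rw [MM_L_zero ν _ (by omega), if_pos rfl, mul_one]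
    congr 1
    push_cast
    ring
  · intro a ha
    rw [MM_L_zero ν _ (by omega), if_neg ha, mul_zero]

lemma Fpoly_eq_XX {F : Type*} [Field F] {q : F} (hq : q ≠ 0) (hq1 : ∀ n : ℕ, 0 < n → q ^ n ≠ 1)
    (h2 : (2 : F) ≠ 0) (g : ℤ → F) (hg : ∀ r, g (-r) = -(q ^ (-r) * g r)) (ν s : ℕ) (hs : s ≤ ν)
    (hg2 : ∀ r, g (-(2 * (ν : ℤ) + 3) - r) = g r)
    (hg0 : ∀ b : ℕ, b ≤ ν → g (-(b + 1)) = if b = s then 1 else 0) (L b : ℕ) (hb : b ≤ ν) :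
    Fpoly ν s b (L + 1) q = XX q g ν b (L + 1) := by
  induction L generalizing b with
  | zero =>
    rw [Fpoly_one hq hq1 ν s b hs hb]
    induction b with
    | zero =>
      rw [XX_rec0 hq hq1 h2 g hg, XX_zero, hg0 ν le_rfl]
      apply if_congr _ rfl rfl
      omega
    | succ b ih =>
      have h := XX_rec hq hq1 h2 g hg ν b 0 hg2 hb
      rw [XX_zero, hg0 _ (by omega), ← ih (by omega)] at h
      rw [sub_eq_iff_eq_add] at h
      rw [h]
      rw [zero_mul, pow_zero, one_mul]
      by_cases c1 : ν ≤ s + b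
      · rw [if_pos c1, if_pos (by omega), if_neg (by omega)]
        ring
      · rw [if_neg c1]
        by_cases c2 : ν ≤ s + (b + 1)
        · rw [if_pos c2, if_pos (by omega)]; ring
        · rw [if_neg c2, if_neg (by omega)]; ring
  | succ L ihL =>
    induction b with
    | zero =>
      rw [XX_rec0 hq hq1 h2 g hg, Fpoly_rec0 hq ν s hs, ihL ν le_rfl]
    | succ b ih =>
      have h := XX_rec hq hq1 h2 g hg ν b (L + 1) hg2 hb
      have h' := Fpoly_rec hq hq1 ν s hs b hb (L + 1) (by omega)
      rw [ihL _ (by omega), ih (by omega), ← h] at h'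
      exact sub_left_inj.mp h'

/-! ### The sign function and the final identification -/

/-- triangular numbers -/
def tri (m : ℤ) : ℤ := m * (m + 1) / 2

lemma tri_two (m : ℤ) : 2 * tri m = m * (m + 1) := by
  unfold tri
  exact Int.mul_ediv_cancel' (Int.even_mul_succ_self m).two_dvd

/-- half of the theta coefficient -/
def hh {F : Type*} [Field F] (q : F) (k S : ℤ) (r : ℤ) : F :=
  if k ∣ r + S then (-1) ^ ((r + S) / k) * q ^ (k * tri ((r + S) / k) - (r + S) / k * S) else 0

/-- the theta coefficient -/
def gg {F : Type*} [Field F] (q : F) (k S : ℤ) (r : ℤ) : F := hh q k S r + hh q k S (-k - r)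

lemma hh_at {F : Type*} [Field F] (q : F) (k S m r : ℤ) (hk : k ≠ 0) (hr : r + S = k * m) :
    hh q k S r = (-1) ^ m * q ^ (k * tri m - m * S) := by
  unfold hh
  rw [hr, if_pos (Dvd.intro m rfl), Int.mul_ediv_cancel_left m hk]

lemma hh_none {F : Type*} [Field F] (q : F) (k S r : ℤ) (hr : ¬ k ∣ r + S) :
    hh q k S r = 0 := if_neg hr

lemma hh_step {F : Type*} [Field F] {q : F} (hq : q ≠ 0) (k S r : ℤ) (hk : k ≠ 0) :
    hh q k S (r - k) = -(q ^ (-r) * hh q k S r) := by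
  by_cases h : k ∣ r + S
  · obtain ⟨m, hm⟩ := h
    rw [hh_at q k S m r hk hm, hh_at q k S (m - 1) (r - k) hk (by linear_combination hm),
      zpow_sub_one₀ (by norm_num)]
    have e : q ^ (k * tri (m - 1) - (m - 1) * S) = q ^ (-r) * q ^ (k * tri m - m * S) := by
      rw [← zpow_add₀ hq]
      congr 1
      have h1 := tri_two m
      have h2 := tri_two (m - 1)
      have h3 : tri (m - 1) = tri m - m := by linarith [h1, h2, mul_comm m m]
      rw [h3]
      linear_combination hm
    rw [e]
    norm_num
    ring
  · rw [hh_none q k S r h, hh_none, mul_zero, neg_zero]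
    intro h'
    apply h
    have := dvd_add h' (dvd_refl k)
    rwa [show r - k + S + k = r + S by ring] at this

lemma gg_neg {F : Type*} [Field F] {q : F} (hq : q ≠ 0) (k S r : ℤ) (hk : k ≠ 0) :
    gg q k S (-r) = -(q ^ (-r) * gg q k S r) := by
  unfold gg
  have h1 := hh_step hq k S r hk
  have h2 := hh_step hq k S (-r) hk
  rw [show -k - -r = r - k by ring, show -k - r = -r - k by ring, h1, h2]
  have e : q ^ (-r) * q ^ (- -r) = 1 := by rw [← zpow_add₀ hq]; simp
  linear_combination -(hh q k S (-r)) * e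

lemma gg_refl {F : Type*} [Field F] {q : F} (k S r : ℤ) :
    gg q k S (-k - r) = gg q k S r := by
  unfold gg
  rw [show -k - (-k - r) = r by ring]
  ring

lemma gg_init {F : Type*} [Field F] {q : F} (ν s b : ℕ) (hs : s ≤ ν) (hb : b ≤ ν) :
    gg q (2 * (ν : ℤ) + 3) (s + 1) (-((b : ℤ) + 1)) = if b = s then 1 else 0 := by
  unfold gg
  have hk : (2 * (ν : ℤ) + 3) ≠ 0 := by omega
  rw [hh_none q _ _ (-(2 * (ν : ℤ) + 3) - -((b : ℤ) + 1)), add_zero]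
  · by_cases h : b = s
    · rw [if_pos h, hh_at q _ _ 0 _ hk (by rw [h]; ring)]
      simp [tri]
    · rw [if_neg h, hh_none]
      intro hd
      have := Int.eq_zero_of_abs_lt_dvd hd (by rw [abs_lt]; constructor <;> omega)
      omega
  · intro hd
    have h2 := dvd_add hd (dvd_refl (2 * (ν : ℤ) + 3))
    have := Int.eq_zero_of_abs_lt_dvd h2 (by rw [abs_lt]; constructor <;> omega)
    omega

lemma XX_split {F : Type*} [Field F] (q : F) (k S : ℤ) (ν b L : ℕ) :
    XX q (gg q k S) ν b L
      = ∑ᶠ a : ℤ, hh q k S (2 * a - (ν * L + b + 1)) * MM q ν L (ν - b) a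
      + ∑ᶠ a : ℤ, hh q k S (-k - (2 * a - (ν * L + b + 1))) * MM q ν L (ν - b) a := by
  have hf : {a : ℤ | MM q ν L (ν - b) a ≠ 0}.Finite := by
    have := MM_fin q ν L (ν - b) 0
    simpa using this
  rw [← finsum_add_distrib (by exact supp_mul _ _ hf) (by exact supp_mul _ _ hf)]
  unfold XX gg
  apply finsum_congr
  intro a
  ring

/-- `W` as a difference of two sums -/
lemma W_split {F : Type*} [Field F] {q : F} (hq : q ≠ 0) (hq1 : ∀ n : ℕ, 0 < n → q ^ n ≠ 1)
    (ν : ℕ) (hν : 1 ≤ ν) (S : ℤ) (b L : ℕ) (hb : b ≤ ν) (u v : ℤ)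
    (hu : 2 * u = ν * L + b + 1 - S) (hv : 2 * v = ν * L + b + 1 + S) :
    W ν S (ν - b) L q
      = ∑ᶠ j : ℤ, q ^ (j * ((2 * j + 1) * (2 * (ν : ℤ) + 3) - 2 * S)) *
          MM q ν L (ν - b) (u + (2 * (ν : ℤ) + 3) * j)
      + ∑ᶠ j : ℤ, (-q ^ ((2 * j + 1) * ((2 * (ν : ℤ) + 3) * j + S))) *
          MM q ν L (ν - b) (v + (2 * (ν : ℤ) + 3) * j) := by
  have hk : (2 * (ν : ℤ) + 3) ≠ 0 := by omega
  have hf : ∀ c : ℤ, {j : ℤ | MM q ν L (ν - b) (c + (2 * (ν : ℤ) + 3) * j) ≠ 0}.Finite := by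
    intro c
    have h := MM_fin q ν L (ν - b) 0
    refine (h.preimage (f := fun j => c + (2 * (ν : ℤ) + 3) * j) ?_).subset ?_
    · intro x _ y _ hxy
      exact mul_left_cancel₀ hk (add_left_cancel hxy)
    · intro j hj
      simpa using hj
  rw [← finsum_add_distrib (by exact supp_mul _ _ (hf u)) (by exact supp_mul _ _ (hf v))]
  unfold W
  apply finsum_congr
  intro j
  have e1 : ((ν : ℤ) * ((L : ℤ) + 1) - S - ((ν - b : ℕ) : ℤ) + 1) / 2 = u := by
    rw [show (ν : ℤ) * ((L : ℤ) + 1) - S - ((ν - b : ℕ) : ℤ) + 1 = 2 * u by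
      rw [hu]; push_cast [hb]; ring]
    omega
  have e2 : ((ν : ℤ) * ((L : ℤ) + 1) + S - ((ν - b : ℕ) : ℤ) + 1) / 2 = v := by
    rw [show (ν : ℤ) * ((L : ℤ) + 1) + S - ((ν - b : ℕ) : ℤ) + 1 = 2 * v by
      rw [hv]; push_cast [hb]; ring]
    omega
  rw [e1, e2, qMulti_eq hq hq1 ν L _ hν (by omega), qMulti_eq hq hq1 ν L _ hν (by omega)]
  ring

/-- one half of the sum, restricted to the arguments where the coefficient is non-zero -/
lemma half_sum {F : Type*} [Field F] (q : F) (k S : ℤ) (hk : k ≠ 0) (ρ : ℤ → ℤ) (M : ℤ → F)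
    (u : ℤ) (C : ℤ → F) (hC : ∀ j, hh q k S (ρ (u + k * j)) = C j)
    (hρ : ∀ a, k ∣ ρ a + S → k ∣ a - u) :
    ∑ᶠ a : ℤ, hh q k S (ρ a) * M a = ∑ᶠ j : ℤ, C j * M (u + k * j) := by
  rw [finsum_inj (fun j : ℤ => u + k * j)]
  · apply finsum_congr
    intro j
    rw [hC]
  · intro x y hxy
    exact mul_left_cancel₀ hk (add_left_cancel hxy)
  · intro a ha
    have hd : k ∣ ρ a + S := by
      by_contra h
      exact ha (by rw [hh_none q k S _ h, zero_mul])
    obtain ⟨j, hj⟩ := hρ a hd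
    exact ⟨j, by linear_combination -hj⟩

lemma dvd_half (ν : ℕ) (x : ℤ) (h : (2 * (ν : ℤ) + 3) ∣ 2 * x) : (2 * (ν : ℤ) + 3) ∣ x := by
  apply IsCoprime.dvd_of_dvd_mul_left _ h
  exact ⟨1, -((ν : ℤ) + 1), by ring⟩

lemma neg_one_even {F : Type*} [Field F] (j : ℤ) : (-1 : F) ^ (2 * j) = 1 :=
  Even.neg_one_zpow (even_two_mul j)

lemma neg_one_odd {F : Type*} [Field F] (j : ℤ) : (-1 : F) ^ (2 * j + 1) = -1 :=
  Odd.neg_one_zpow (odd_two_mul_add_one j)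

lemma XX_eq_W1 {F : Type*} [Field F] {q : F} (hq : q ≠ 0) (hq1 : ∀ n : ℕ, 0 < n → q ^ n ≠ 1)
    (ν : ℕ) (hν : 1 ≤ ν) (S : ℤ) (b L : ℕ) (hb : b ≤ ν) (u : ℤ)
    (hu : 2 * u = ν * L + b + 1 - S) :
    XX q (gg q (2 * (ν : ℤ) + 3) S) ν b L = W ν S (ν - b) L q := by
  have hk : (2 * (ν : ℤ) + 3) ≠ 0 := by omega
  rw [XX_split, W_split hq hq1 ν hν S b L hb u (u + S) hu (by linarith)]
  congr 1
  · apply half_sum q _ S hk (fun a => 2 * a - (ν * L + b + 1))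
    · intro j
      rw [hh_at q _ S (2 * j) _ hk (by linear_combination hu), neg_one_even, one_mul]
      congr 1
      have := tri_two (2 * j)
      have e : tri (2 * j) = j * (2 * j + 1) := by linarith
      rw [e]; ring
    · intro a h
      apply dvd_half
      convert h using 1
      linear_combination -hu
  · apply half_sum q _ S hk (fun a => -(2 * (ν : ℤ) + 3) - (2 * a - (ν * L + b + 1)))
    · intro j
      rw [hh_at q _ S (2 * (-j - 1) + 1) _ hk (by linear_combination -hu), neg_one_odd, neg_one_mul]
      congr 2
      have := tri_two (2 * (-j - 1) + 1)
      have e : tri (2 * (-j - 1) + 1) = j * (2 * j + 1) := by linarith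
      rw [e]; ring
    · intro a h
      apply dvd_half
      have h3 := (dvd_add h (dvd_refl (2 * (ν : ℤ) + 3))).neg_right
      have e : 2 * (a - (u + S)) = -(-(2 * (ν : ℤ) + 3) - (2 * a - (ν * L + b + 1)) + S
          + (2 * (ν : ℤ) + 3)) := by linear_combination -hu
      rw [e]
      exact h3

lemma XX_eq_W2 {F : Type*} [Field F] {q : F} (hq : q ≠ 0) (hq1 : ∀ n : ℕ, 0 < n → q ^ n ≠ 1)
    (ν : ℕ) (hν : 1 ≤ ν) (S : ℤ) (b L : ℕ) (hb : b ≤ ν) (u : ℤ)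
    (hu : 2 * u = ν * L + b + 1 - (2 * (ν : ℤ) + 3 - S)) :
    XX q (gg q (2 * (ν : ℤ) + 3) S) ν b L = W ν (2 * (ν : ℤ) + 3 - S) (ν - b) L q := by
  have hk : (2 * (ν : ℤ) + 3) ≠ 0 := by omega
  rw [XX_split, W_split hq hq1 ν hν _ b L hb u (u + (2 * (ν : ℤ) + 3 - S)) hu (by linarith), add_comm]
  congr 1
  · apply half_sum q _ S hk (fun a => -(2 * (ν : ℤ) + 3) - (2 * a - (ν * L + b + 1)))
    · intro j
      rw [hh_at q _ S (2 * (-j)) _ hk (by linear_combination -hu), neg_one_even, one_mul]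
      congr 1
      have := tri_two (2 * (-j))
      have e : tri (2 * (-j)) = j * (2 * j - 1) := by linarith
      rw [e]; ring
    · intro a h
      apply dvd_half
      have h3 := h.neg_right
      have e : 2 * (a - u) = -(-(2 * (ν : ℤ) + 3) - (2 * a - (ν * L + b + 1)) + S) := by
        linear_combination -hu
      rw [e]
      exact h3
  · apply half_sum q _ S hk (fun a => 2 * a - (ν * L + b + 1))
    · intro j
      rw [hh_at q _ S (2 * j + 1) _ hk (by linear_combination hu), neg_one_odd, neg_one_mul]
      congr 2
      have := tri_two (2 * j + 1)
      have e : tri (2 * j + 1) = (j + 1) * (2 * j + 1) := by linarith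
      rw [e]; ring
    · intro a h
      apply dvd_half
      have h3 := dvd_sub h (dvd_refl (2 * (ν : ℤ) + 3))
      have e : 2 * (a - (u + (2 * (ν : ℤ) + 3 - S)))
          = 2 * a - (ν * L + b + 1) + S - (2 * (ν : ℤ) + 3) := by linear_combination -hu
      rw [e]
      exact h3

lemma X_pow_ne (n : ℕ) (hn : 0 < n) : (RatFunc.X : K) ^ n ≠ 1 := by
  intro h
  rw [← RatFunc.algebraMap_X, ← map_pow, ← map_one (algebraMap (Polynomial ℚ) K)] at h
  have h2 := RatFunc.algebraMap_injective ℚ h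
  have h3 := congrArg (Polynomial.eval 0) h2
  simp [hn.ne'] at h3


theorem stmt_14 (ν : ℕ) (hν : 1 ≤ ν) (s b : ℕ) (hs : s ≤ ν) (hb : b ≤ ν) (L : ℕ) (hL : 2 ≤ L) :
    (((b : ℤ) + s ≡ (ν : ℤ) * L [ZMOD 2]) →
      Fpoly ν s b L (RatFunc.X : K) = W ν ((s : ℤ) + 1) (ν - b) L RatFunc.X) ∧
    (¬ ((b : ℤ) + s ≡ (ν : ℤ) * L [ZMOD 2]) →
      Fpoly ν s b L (RatFunc.X : K) = W ν (2 * (ν : ℤ) + 2 - s) (ν - b) L RatFunc.X) := by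
  have hq : (RatFunc.X : K) ≠ 0 := RatFunc.X_ne_zero
  have hq1 := X_pow_ne
  have hk : (2 * (ν : ℤ) + 3) ≠ 0 := by omega
  obtain ⟨l, rfl⟩ : ∃ l, L = l + 1 := ⟨L - 1, by omega⟩
  have h := Fpoly_eq_XX hq hq1 (two_ne_zero) (gg RatFunc.X (2 * (ν : ℤ) + 3) (s + 1))
    (fun r => gg_neg hq _ _ r hk) ν s hs (fun r => gg_refl _ _ r)
    (fun b hb => gg_init ν s b hs hb) l b hb
  rw [h]
  generalize hz : (ν : ℤ) * ((l + 1 : ℕ) : ℤ) = z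
  unfold Int.ModEq
  constructor
  · intro hp
    exact XX_eq_W1 hq hq1 ν hν _ b (l + 1) hb ((z + b - s) / 2) (by rw [hz]; omega)
  · intro hp
    rw [show 2 * (ν : ℤ) + 2 - s = 2 * (ν : ℤ) + 3 - (s + 1) by ring]
    exact XX_eq_W2 hq hq1 ν hν _ b (l + 1) hb ((z + b + s - 1) / 2 - ν) (by rw [hz]; omega)

end
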